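/- Let (R, m) be a commutative Noetherian local ring, a an ideal of R, d a natural number, and p a prime ideal of R with dim R/p ≤ d. Then the following are equivalent: (i) cd_R(a, R/p) = d; (ii) there exists a prime ideal p* of the m-adic completion R̂ such that p* ∩ R = p, dim R̂/p* = d, and dim R̂/(a R̂ + p*) = 0. -/

import Mathlib

/- Common definitions: local cohomology modules, cohomological dimension, module dimension,
secondary representations and attached primes. -/

open CategoryTheory TensorProduct

/-- The `i`-th local cohomology module `H^i_a(M)`, as a type with its `R`-module structure. -/
noncomputable def TopLC (R : Type) [CommRing R] (a : Ideal R) (i : ℕ)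
    (M : Type) [AddCommGroup M] [Module R M] : Type :=
  ((localCohomology a i).obj (ModuleCat.of R M))

noncomputable instance (R : Type) [CommRing R] (a : Ideal R) (i : ℕ)
    (M : Type) [AddCommGroup M] [Module R M] : AddCommGroup (TopLC R a i M) :=
  inferInstanceAs (AddCommGroup ((localCohomology a i).obj (ModuleCat.of R M)))

noncomputable instance (R : Type) [CommRing R] (a : Ideal R) (i : ℕ)
    (M : Type) [AddCommGroup M] [Module R M] : Module R (TopLC R a i M) :=
  inferInstanceAs (Module R ((localCohomology a i).obj (ModuleCat.of R M)))

/-- The cohomological dimension `cd_R(a, M) = sup { i | H^i_a(M) ≠ 0 }`,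
with value `⊥` if all local cohomology modules vanish. -/
noncomputable def cohDim (R : Type) [CommRing R] (a : Ideal R)
    (M : Type) [AddCommGroup M] [Module R M] : WithBot ℕ∞ :=
  sSup {n : WithBot ℕ∞ | ∃ i : ℕ, n = (i : ℕ) ∧ Nontrivial (TopLC R a i M)}

/-- The (Krull) dimension of a module, i.e. the Krull dimension of its support. -/
noncomputable def moduleDim (R : Type) [CommRing R]
    (M : Type) [AddCommGroup M] [Module R M] : WithBot ℕ∞ :=
  Order.krullDim (Module.support R M)

/-- `Assh_R M`: the associated primes `p` of `M` with `dim R/p = dim M`. -/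
noncomputable def Assh (R : Type) [CommRing R]
    (M : Type) [AddCommGroup M] [Module R M] : Set (Ideal R) :=
  { p | p ∈ associatedPrimes R M ∧ ringKrullDim (R ⧸ p) = moduleDim R M }

/-- A submodule `S` is secondary if `S ≠ 0` and every `r : R` acts on `S` either
surjectively or nilpotently. -/
def IsSecondarySub (R : Type) [CommRing R] {M : Type} [AddCommGroup M] [Module R M]
    (S : Submodule R M) : Prop :=
  S ≠ ⊥ ∧ ∀ r : R, (∀ m ∈ S, ∃ s ∈ S, r • s = m) ∨ (∃ n : ℕ, ∀ m ∈ S, r ^ n • m = 0)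

/-- A module is representable if it is the (finite) sum of secondary submodules. -/
def IsRepresentable (R : Type) [CommRing R] (M : Type) [AddCommGroup M] [Module R M] : Prop :=
  ∃ (n : ℕ) (S : Fin n → Submodule R M), (∀ i, IsSecondarySub R (S i)) ∧ (⨆ i, S i) = ⊤

/-- A minimal secondary representation: secondary submodules summing to the whole module,
with pairwise distinct attached primes, none contained in the sum of the others. -/
def IsMinimalRep (R : Type) [CommRing R] {M : Type} [AddCommGroup M] [Module R M]
    {n : ℕ} (S : Fin n → Submodule R M) : Prop :=
  (∀ i, IsSecondarySub R (S i)) ∧ (⨆ i, S i) = ⊤ ∧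
    (Function.Injective fun i => (S i).annihilator.radical) ∧
    ∀ j, ¬ (S j ≤ ⨆ i ∈ ({j}ᶜ : Set (Fin n)), S i)

/-- The attached primes of a module: the radicals of the annihilators of the terms of a
minimal secondary representation. -/
def AttachedPrimes (R : Type) [CommRing R] (M : Type) [AddCommGroup M] [Module R M] :
    Set (Ideal R) :=
  { p | ∃ (n : ℕ) (S : Fin n → Submodule R M), IsMinimalRep R S ∧
      ∃ i, p = (S i).annihilator.radical }

/-- `stab b N = ⟨b⟩N = ⋂ₙ bⁿN`. -/
def stab {R M : Type} [CommRing R] [AddCommGroup M] [Module R M]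
    (b : Ideal R) (N : Submodule R M) : Submodule R M :=
  ⨅ n : ℕ, b ^ n • N

universe u

/-- The transition map `A ⧸ a ^ m ⟶ A ⧸ a ^ n` for `n ≤ m`. -/
noncomputable def powQuotMap {A : Type u} [CommRing A] (a : Ideal A) {n m : ℕ} (h : n ≤ m) :
    ModuleCat.of A (A ⧸ a ^ m) ⟶ ModuleCat.of A (A ⧸ a ^ n) :=
  ModuleCat.ofHom (Submodule.factor (Ideal.pow_le_pow_right h))

lemma powQuotMap_self {A : Type u} [CommRing A] (a : Ideal A) (n : ℕ) :
    powQuotMap a (le_refl n) = 𝟙 _ := by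
  apply ModuleCat.hom_ext
  ext
  rfl

lemma powQuotMap_comp {A : Type u} [CommRing A] (a : Ideal A) {n m k : ℕ} (h : n ≤ m)
    (h' : m ≤ k) : powQuotMap a h' ≫ powQuotMap a h = powQuotMap a (h.trans h') := by
  apply ModuleCat.hom_ext
  ext
  rfl

/-- The transition maps `Ext (A ⧸ a ^ n) M i → Ext (A ⧸ a ^ m) M i` for `n ≤ m`. -/
noncomputable def extTrans {A : Type u} [CommRing A] (a : Ideal A) (i : ℕ)
    (M : Type u) [AddCommGroup M] [Module A M] (n m : ℕ) (h : n ≤ m) :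
    Abelian.Ext (ModuleCat.of A (A ⧸ a ^ n)) (ModuleCat.of A M) i →ₗ[A]
      Abelian.Ext (ModuleCat.of A (A ⧸ a ^ m)) (ModuleCat.of A M) i :=
  (Abelian.Ext.mk₀ (powQuotMap a h)).precompOfLinear A _ (zero_add i)

/-- Local cohomology as the direct limit of `Ext (A ⧸ a ^ n) M i`. -/
noncomputable def ExtLC {A : Type u} [CommRing A] (a : Ideal A) (i : ℕ)
    (M : Type u) [AddCommGroup M] [Module A M] : Type u :=
  Module.DirectLimit
    (fun n : ℕ => Abelian.Ext (ModuleCat.of A (A ⧸ a ^ n)) (ModuleCat.of A M) i)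
    (extTrans a i M)

namespace ExtLC

open Abelian

variable {A : Type u} [CommRing A] (a : Ideal A) (i : ℕ)
variable (M : Type u) [AddCommGroup M] [Module A M]
variable {N : Type u} [AddCommGroup N] [Module A N]
variable {P : Type u} [AddCommGroup P] [Module A P]

noncomputable instance : AddCommGroup (ExtLC a i M) :=
  inferInstanceAs (AddCommGroup (Module.DirectLimit _ (extTrans a i M)))

noncomputable instance : Module A (ExtLC a i M) :=
  inferInstanceAs (Module A (Module.DirectLimit _ (extTrans a i M)))

instance directedSystem_extTrans : DirectedSystem
    (fun n : ℕ => Ext (ModuleCat.of A (A ⧸ a ^ n)) (ModuleCat.of A M) i)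
    (fun n m h => extTrans a i M n m h) where
  map_self n x := by
    simp [extTrans, powQuotMap_self]
  map_map k j n hij hjk x := by
    rw [extTrans, extTrans, extTrans, ← powQuotMap_comp a hij hjk]
    exact Ext.mk₀_comp_mk₀_assoc _ _ x

/-- The structure map from `Ext (A ⧸ a ^ n) M i`. -/
noncomputable def of (n : ℕ) :
    Ext (ModuleCat.of A (A ⧸ a ^ n)) (ModuleCat.of A M) i →ₗ[A] ExtLC a i M :=
  Module.DirectLimit.of A ℕ _ (extTrans a i M) n

variable {a i M}

lemma exists_of (z : ExtLC a i M) : ∃ n e, of a i M n e = z :=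
  Module.DirectLimit.exists_of (f := extTrans a i M) z

lemma of_trans {n m : ℕ} (h : n ≤ m)
    (e : Ext (ModuleCat.of A (A ⧸ a ^ n)) (ModuleCat.of A M) i) :
    of a i M m ((Ext.mk₀ (powQuotMap a h)).comp e (zero_add i)) = of a i M n e :=
  Module.DirectLimit.of_f (f := extTrans a i M) (hij := h)

lemma of_eq_zero_iff {n : ℕ} (e : Ext (ModuleCat.of A (A ⧸ a ^ n)) (ModuleCat.of A M) i) :
    of a i M n e = 0 ↔
      ∃ (m : ℕ) (h : n ≤ m), (Ext.mk₀ (powQuotMap a h)).comp e (zero_add i) = 0 := by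
  constructor
  · intro h
    exact Module.DirectLimit.of.zero_exact (f := extTrans a i M) h
  · rintro ⟨m, h, he⟩
    rw [← of_trans h, he, map_zero]

/-- Yoneda product with an `Ext` class on local cohomology. -/
noncomputable def comp {j k : ℕ} (h : i + j = k)
    (β : Ext (ModuleCat.of A M) (ModuleCat.of A N) j) : ExtLC a i M →ₗ[A] ExtLC a k N :=
  Module.DirectLimit.map (f := extTrans a i M) (f' := extTrans a k N)
    (fun n => β.postcompOfLinear A _ h) (fun n m hnm => by
      ext e
      exact Ext.comp_assoc _ _ _ (zero_add i) h (by omega))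

lemma comp_of {j k : ℕ} (h : i + j = k)
    (β : Ext (ModuleCat.of A M) (ModuleCat.of A N) j) {n : ℕ}
    (e : Ext (ModuleCat.of A (A ⧸ a ^ n)) (ModuleCat.of A M) i) :
    comp h β (of a i M n e) = of a k N n (e.comp β h) :=
  Module.DirectLimit.map_apply_of (f := extTrans a i M) (f' := extTrans a k N) _ _ _

variable (a i) in
/-- Functoriality of local cohomology. -/
noncomputable def map (f : M →ₗ[A] N) : ExtLC a i M →ₗ[A] ExtLC a i N :=
  comp (add_zero i) (Ext.mk₀ (ModuleCat.ofHom f))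

lemma map_of (f : M →ₗ[A] N) {n : ℕ}
    (e : Ext (ModuleCat.of A (A ⧸ a ^ n)) (ModuleCat.of A M) i) :
    map a i f (of a i M n e) = of a i N n (e.comp (Ext.mk₀ (ModuleCat.ofHom f)) (add_zero i)) :=
  comp_of _ _ _

lemma map_comp_apply (f : M →ₗ[A] N) (g : N →ₗ[A] P) (z : ExtLC a i M) :
    map a i g (map a i f z) = map a i (g ∘ₗ f) z := by
  obtain ⟨n, e, rfl⟩ := exists_of z
  simp [map_of]

lemma map_id_apply (z : ExtLC a i M) : map a i (LinearMap.id : M →ₗ[A] M) z = z := by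
  obtain ⟨n, e, rfl⟩ := exists_of z
  simp [map_of]

lemma map_zero_apply (z : ExtLC a i M) : map a i (0 : M →ₗ[A] N) z = 0 := by
  obtain ⟨n, e, rfl⟩ := exists_of z
  simp [map_of]

lemma map_smul_apply (r : A) (f : M →ₗ[A] N) (z : ExtLC a i M) :
    map a i (r • f) z = r • map a i f z := by
  obtain ⟨n, e, rfl⟩ := exists_of z
  rw [map_of, map_of, ← map_smul, ← Ext.comp_smul, ← Ext.mk₀_smul]
  rfl

lemma map_lsmul_apply (r : A) (z : ExtLC a i M) :
    map a i (LinearMap.lsmul A M r) z = r • z := by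
  have : LinearMap.lsmul A M r = r • LinearMap.id := by ext; simp
  rw [this, map_smul_apply, map_id_apply]

/-- `map` of a linear equivalence. -/
lemma subsingleton_congr (e : M ≃ₗ[A] N) : Subsingleton (ExtLC a i M) ↔
    Subsingleton (ExtLC a i N) := by
  have h1 (z) : map a i (e.symm : N →ₗ[A] M) (map a i (e : M →ₗ[A] N) z) = z := by
    rw [map_comp_apply]; simp [map_id_apply]
  have h2 (z) : map a i (e : M →ₗ[A] N) (map a i (e.symm : N →ₗ[A] M) z) = z := by
    rw [map_comp_apply]; simp [map_id_apply]
  constructor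
  · intro h
    exact ⟨fun x y => by rw [← h2 x, ← h2 y, Subsingleton.elim (map a i (e.symm : N →ₗ[A] M) x)]⟩
  · intro h
    exact ⟨fun x y => by rw [← h1 x, ← h1 y, Subsingleton.elim (map a i (e : M →ₗ[A] N) x)]⟩

section Exact

variable {f : M →ₗ[A] N} {g : N →ₗ[A] P}

lemma shortExact_moduleCat (hf : Function.Injective f) (hg : Function.Surjective g)
    (hfg : Function.Exact f g) :
    (ShortComplex.mk (ModuleCat.ofHom f) (ModuleCat.ofHom g)
      (by rw [← ModuleCat.ofHom_comp, hfg.linearMap_comp_eq_zero]; rfl)).ShortExact :=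
  ModuleCat.shortComplex_shortExact _ hfg hf hg

variable (a i) in
/-- The connecting homomorphism. -/
noncomputable def δ (hf : Function.Injective f) (hg : Function.Surjective g)
    (hfg : Function.Exact f g) : ExtLC a i P →ₗ[A] ExtLC a (i + 1) M :=
  comp rfl (shortExact_moduleCat hf hg hfg).extClass

variable (hf : Function.Injective f) (hg : Function.Surjective g) (hfg : Function.Exact f g)

variable (a i)

include hf hg hfg in
lemma exact₂ : Function.Exact (map a i f) (map a i g) := by
  intro z
  constructor
  · intro h
    obtain ⟨n, e, rfl⟩ := exists_of z
    rw [map_of, of_eq_zero_iff] at h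
    obtain ⟨m, hm, h⟩ := h
    rw [← Ext.comp_assoc_of_third_deg_zero] at h
    obtain ⟨x, hx⟩ := Ext.covariant_sequence_exact₂ _ (shortExact_moduleCat hf hg hfg) _ h
    refine ⟨of a i M m x, ?_⟩
    rw [map_of, ← of_trans hm, ← hx]
  · rintro ⟨y, rfl⟩
    rw [map_comp_apply, hfg.linearMap_comp_eq_zero, map_zero_apply]

lemma exact₃ : Function.Exact (map a i g) (δ a i hf hg hfg) := by
  intro z
  constructor
  · intro h
    obtain ⟨n, e, rfl⟩ := exists_of z
    rw [δ, comp_of, of_eq_zero_iff] at h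
    obtain ⟨m, hm, h⟩ := h
    rw [← Ext.comp_assoc _ _ _ (zero_add i) rfl (by omega)] at h
    obtain ⟨x, hx⟩ := Ext.covariant_sequence_exact₃ _ (shortExact_moduleCat hf hg hfg) _ _ h
    refine ⟨of a i N m x, ?_⟩
    rw [map_of, ← of_trans hm, ← hx]
  · rintro ⟨y, rfl⟩
    obtain ⟨n, e, rfl⟩ := exists_of y
    rw [map_of, δ, comp_of, Ext.comp_assoc_of_second_deg_zero,
      (shortExact_moduleCat hf hg hfg).comp_extClass, Ext.comp_zero, map_zero]

lemma exact₁ : Function.Exact (δ a i hf hg hfg) (map a (i + 1) f) := by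
  intro z
  constructor
  · intro h
    obtain ⟨n, e, rfl⟩ := exists_of z
    rw [map_of, of_eq_zero_iff] at h
    obtain ⟨m, hm, h⟩ := h
    rw [← Ext.comp_assoc_of_third_deg_zero] at h
    obtain ⟨x, hx⟩ := Ext.covariant_sequence_exact₁ _ (shortExact_moduleCat hf hg hfg) _ h rfl
    refine ⟨of a i P m x, ?_⟩
    rw [δ, comp_of, ← of_trans hm, ← hx]
  · rintro ⟨y, rfl⟩
    obtain ⟨n, e, rfl⟩ := exists_of y
    rw [δ, comp_of, map_of, Ext.comp_assoc_of_third_deg_zero,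
      (shortExact_moduleCat hf hg hfg).extClass_comp, Ext.comp_zero, map_zero]

end Exact

end ExtLC

/-- The submodule of elements killed by a power of the ideal `a`. -/
def powTorsion {A : Type*} [CommRing A] (a : Ideal A) (M : Type*) [AddCommGroup M] [Module A M] :
    Submodule A M where
  carrier := {x | ∃ n : ℕ, ∀ r ∈ a ^ n, r • x = 0}
  zero_mem' := ⟨0, fun r _ => smul_zero r⟩
  add_mem' := by
    rintro x y ⟨n, hn⟩ ⟨m, hm⟩
    refine ⟨n + m, fun r hr => ?_⟩
    rw [smul_add, hn r (Ideal.pow_le_pow_right (by omega) hr),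
      hm r (Ideal.pow_le_pow_right (by omega) hr), add_zero]
  smul_mem' := by
    rintro c x ⟨n, hn⟩
    exact ⟨n, fun r hr => by rw [smul_comm, hn r hr, smul_zero]⟩

lemma mem_powTorsion {A : Type*} [CommRing A] {a : Ideal A} {M : Type*} [AddCommGroup M]
    [Module A M] {x : M} : x ∈ powTorsion a M ↔ ∃ n : ℕ, ∀ r ∈ a ^ n, r • x = 0 := Iff.rfl

lemma map_mem_powTorsion {A : Type*} [CommRing A] {a : Ideal A} {M N : Type*} [AddCommGroup M]
    [Module A M] [AddCommGroup N] [Module A N] (f : M →ₗ[A] N) {x : M}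
    (hx : x ∈ powTorsion a M) : f x ∈ powTorsion a N := by
  obtain ⟨n, hn⟩ := hx
  exact ⟨n, fun r hr => by rw [← map_smul, hn r hr, map_zero]⟩

lemma powTorsion_eq_top_of_le_annihilator {A : Type*} [CommRing A] {a : Ideal A} {M : Type*}
    [AddCommGroup M] [Module A M] (h : ∀ r ∈ a, ∀ x : M, r • x = 0) : powTorsion a M = ⊤ :=
  eq_top_iff.mpr fun x _ => ⟨1, fun r hr => h r (by simpa using hr) x⟩

/-- A finitely generated torsion module is killed by a power. -/
lemma exists_pow_smul_eq_zero_of_finite {A : Type*} [CommRing A] {a : Ideal A} {M : Type*}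
    [AddCommGroup M] [Module A M] [Module.Finite A M] (h : powTorsion a M = ⊤) :
    ∃ n : ℕ, ∀ r ∈ a ^ n, ∀ x : M, r • x = 0 := by
  obtain ⟨s, hs⟩ := Module.Finite.fg_top (R := A) (M := M)
  have h' (x : M) : ∃ n : ℕ, ∀ r ∈ a ^ n, r • x = 0 := by
    have : x ∈ powTorsion a M := h ▸ trivial
    exact this
  choose n hn using h'
  refine ⟨s.sup n, fun r hr x => ?_⟩
  have hx : x ∈ Submodule.span A (s : Set M) := hs ▸ trivial
  induction hx using Submodule.span_induction with
  | mem x hx => exact hn x r (Ideal.pow_le_pow_right (Finset.le_sup hx) hr)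
  | zero => exact smul_zero r
  | add x y _ _ h1 h2 => rw [smul_add, h1, h2, add_zero]
  | smul c x _ h1 => rw [smul_comm, h1, smul_zero]

namespace ExtLC
open Abelian
variable {A : Type u} [CommRing A] {a : Ideal A} {i : ℕ}
variable {M : Type u} [AddCommGroup M] [Module A M]
variable {N : Type u} [AddCommGroup N] [Module A N]
variable {P : Type u} [AddCommGroup P] [Module A P]

lemma powTorsion_eq_top : powTorsion a (ExtLC a i M) = ⊤ := by
  refine eq_top_iff.mpr fun z _ => ?_
  obtain ⟨n, e, rfl⟩ := exists_of z
  refine ⟨n, fun r hr => ?_⟩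
  rw [← map_smul]
  have h0 : r • 𝟙 (ModuleCat.of A (A ⧸ a ^ n)) = 0 := by
    apply ModuleCat.hom_ext
    ext
    change r • (Submodule.Quotient.mk (1 : A) : A ⧸ a ^ n) = 0
    rw [← Submodule.Quotient.mk_smul, Submodule.Quotient.mk_eq_zero]
    simpa using hr
  have : r • e = (Ext.mk₀ (r • 𝟙 (ModuleCat.of A (A ⧸ a ^ n)))).comp e (zero_add i) := by
    rw [Ext.mk₀_smul, Ext.smul_comp, Ext.mk₀_id_comp]
  rw [this, h0, Ext.mk₀_zero, Ext.zero_comp, map_zero]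

lemma exists_pow_smul_eq_zero {r : A} (hr : r ∈ a) (z : ExtLC a i M) :
    ∃ n : ℕ, r ^ n • z = 0 := by
  have : z ∈ powTorsion a (ExtLC a i M) := powTorsion_eq_top (a := a) (M := M) (i := i) ▸ trivial
  obtain ⟨n, hn⟩ := this
  exact ⟨n, hn _ (Ideal.pow_mem_pow hr n)⟩

lemma subsingleton_of_injective_smul {r : A} (hr : r ∈ a)
    (h : ∀ z : ExtLC a i M, r • z = 0 → z = 0) : Subsingleton (ExtLC a i M) := by
  refine subsingleton_of_forall_eq 0 fun z => ?_
  obtain ⟨n, hn⟩ := exists_pow_smul_eq_zero hr z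
  induction n with
  | zero => simpa using hn
  | succ n ih => exact ih (h _ (by rw [← mul_smul, ← pow_succ', hn]))

/-- Evaluation at `1` in degree zero, before passing to the limit. -/
noncomputable def evalOneAux (a : Ideal A) (M : Type u) [AddCommGroup M] [Module A M] (n : ℕ) :
    Ext (ModuleCat.of A (A ⧸ a ^ n)) (ModuleCat.of A M) 0 →ₗ[A] M where
  toFun e := (Ext.linearEquiv₀ (R := A) e).hom (1 : A ⧸ a ^ n)
  map_add' x y := by rw [map_add]; rfl
  map_smul' r x := by rw [map_smul]; rfl

lemma evalOneAux_mk₀ (n : ℕ) (f : ModuleCat.of A (A ⧸ a ^ n) ⟶ ModuleCat.of A M) :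
    evalOneAux a M n (Ext.mk₀ f) = f.hom (1 : A ⧸ a ^ n) := by
  have : Ext.linearEquiv₀ (R := A) (Ext.mk₀ f) = f :=
    (Ext.linearEquiv₀ (R := A)).apply_symm_apply f
  rw [evalOneAux, LinearMap.coe_mk, AddHom.coe_mk, this]

/-- Local cohomology in degree zero embeds in the module. -/
noncomputable def evalOne (a : Ideal A) (M : Type u) [AddCommGroup M] [Module A M] :
    ExtLC a 0 M →ₗ[A] M :=
  Module.DirectLimit.lift A ℕ _ (extTrans a 0 M) (fun n => evalOneAux a M n) (by
    intro n m h x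
    obtain ⟨f, rfl⟩ := (Ext.homEquiv₀.symm.surjective x)
    change evalOneAux a M m ((Ext.mk₀ (powQuotMap a h)).comp (Ext.mk₀ f) (zero_add 0)) =
      evalOneAux a M n (Ext.mk₀ f)
    rw [Ext.mk₀_comp_mk₀, evalOneAux_mk₀, evalOneAux_mk₀]
    rfl)

lemma evalOne_of_mk₀ (n : ℕ) (f : ModuleCat.of A (A ⧸ a ^ n) ⟶ ModuleCat.of A M) :
    evalOne a M (of a 0 M n (Ext.mk₀ f)) = f.hom (1 : A ⧸ a ^ n) :=
  (Module.DirectLimit.lift_of (f := extTrans a 0 M) _ _ _).trans (evalOneAux_mk₀ n f)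

lemma exists_of_mk₀ (z : ExtLC a 0 M) : ∃ n f, of a 0 M n (Ext.mk₀ f) = z := by
  obtain ⟨n, e, rfl⟩ := exists_of z
  obtain ⟨f, rfl⟩ := Ext.homEquiv₀.symm.surjective e
  exact ⟨n, f, rfl⟩

lemma evalOne_injective : Function.Injective (evalOne a M) := by
  rw [injective_iff_map_eq_zero]
  intro z hz
  obtain ⟨n, f, rfl⟩ := exists_of_mk₀ z
  rw [evalOne_of_mk₀] at hz
  have : f = 0 := by
    apply ModuleCat.hom_ext
    ext
    exact hz
  rw [this, Ext.mk₀_zero, map_zero]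

lemma evalOne_map (f : M →ₗ[A] N) (z : ExtLC a 0 M) :
    evalOne a N (map a 0 f z) = f (evalOne a M z) := by
  obtain ⟨n, g, rfl⟩ := exists_of_mk₀ z
  rw [map_of, Ext.mk₀_comp_mk₀, evalOne_of_mk₀, evalOne_of_mk₀]
  rfl

lemma range_evalOne : LinearMap.range (evalOne a M) = powTorsion a M := by
  ext x
  constructor
  · rintro ⟨z, rfl⟩
    have : z ∈ powTorsion a (ExtLC a 0 M) := powTorsion_eq_top (a := a) (M := M) (i := 0) ▸ trivial
    exact map_mem_powTorsion _ this
  · rintro ⟨n, hn⟩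
    refine ⟨of a 0 M n (Ext.mk₀ (ModuleCat.ofHom
      ((a ^ n).liftQ (LinearMap.toSpanSingleton A M x) ?_))), ?_⟩
    · intro r hr
      simpa using hn r hr
    · rw [evalOne_of_mk₀]
      change (a ^ n).liftQ (LinearMap.toSpanSingleton A M x) _ (Submodule.Quotient.mk 1) = x
      rw [Submodule.liftQ_apply, LinearMap.toSpanSingleton_apply, one_smul]

lemma map_zero_injective {f : M →ₗ[A] N} (hf : Function.Injective f) :
    Function.Injective (map a 0 f) := fun x y h =>
  evalOne_injective (hf (by rw [← evalOne_map, ← evalOne_map, h]))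

lemma map_zero_surjective_iff (f : M →ₗ[A] N) : Function.Surjective (map a 0 f) ↔
    ∀ y ∈ powTorsion a N, ∃ x ∈ powTorsion a M, f x = y := by
  constructor
  · intro h y hy
    rw [← range_evalOne] at hy
    obtain ⟨z, rfl⟩ := hy
    obtain ⟨w, rfl⟩ := h z
    exact ⟨evalOne a M w, range_evalOne (a := a) (M := M) ▸ ⟨w, rfl⟩, (evalOne_map _ _).symm⟩
  · intro h z
    obtain ⟨x, hx, hxz⟩ := h (evalOne a N z) (range_evalOne (a := a) (M := N) ▸ ⟨z, rfl⟩)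
    rw [← range_evalOne] at hx
    obtain ⟨w, rfl⟩ := hx
    exact ⟨w, evalOne_injective (by rw [evalOne_map, hxz])⟩

lemma subsingleton_zero_iff : Subsingleton (ExtLC a 0 M) ↔ powTorsion a M = ⊥ := by
  rw [← range_evalOne, LinearMap.range_eq_bot]
  constructor
  · intro h
    ext z
    rw [Subsingleton.elim z 0, map_zero, map_zero]
  · intro h
    exact subsingleton_of_forall_eq 0 fun z => evalOne_injective (by rw [h]; simp)

section Exact

variable {f : M →ₗ[A] N} {g : N →ₗ[A] P}
  (hf : Function.Injective f) (hg : Function.Surjective g) (hfg : Function.Exact f g)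
include hf hg hfg

lemma subsingleton_mid (h1 : Subsingleton (ExtLC a i M)) (h3 : Subsingleton (ExtLC a i P)) :
    Subsingleton (ExtLC a i N) := by
  refine subsingleton_of_forall_eq 0 fun z => ?_
  obtain ⟨y, rfl⟩ := (exact₂ a i hf hg hfg z).mp (Subsingleton.elim _ _)
  rw [Subsingleton.elim y 0, map_zero]

lemma subsingleton_left (h1 : Subsingleton (ExtLC a i P))
    (h3 : Subsingleton (ExtLC a (i + 1) N)) : Subsingleton (ExtLC a (i + 1) M) := by
  refine subsingleton_of_forall_eq 0 fun z => ?_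
  obtain ⟨y, rfl⟩ := (exact₁ a i hf hg hfg z).mp (Subsingleton.elim _ _)
  rw [Subsingleton.elim y 0, map_zero]

lemma map_injective_of_subsingleton (h1 : Subsingleton (ExtLC a i P)) :
    Function.Injective (map a (i + 1) f) := by
  rw [injective_iff_map_eq_zero]
  intro z hz
  obtain ⟨y, rfl⟩ := (exact₁ a i hf hg hfg z).mp hz
  rw [Subsingleton.elim y 0, map_zero]

lemma subsingleton_right (h1 : Subsingleton (ExtLC a i N))
    (h3 : Subsingleton (ExtLC a (i + 1) M)) : Subsingleton (ExtLC a i P) := by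
  refine subsingleton_of_forall_eq 0 fun z => ?_
  obtain ⟨y, rfl⟩ := (exact₃ a i hf hg hfg z).mp (Subsingleton.elim _ _)
  rw [Subsingleton.elim y 0, map_zero]

lemma map_surjective (h3 : Subsingleton (ExtLC a (i + 1) M)) :
    Function.Surjective (map a i g) := fun z =>
  (exact₃ a i hf hg hfg z).mp (Subsingleton.elim _ _)

lemma subsingleton_left_of_surjective (h0 : Function.Surjective (map a i g))
    (h1 : Subsingleton (ExtLC a (i + 1) N)) : Subsingleton (ExtLC a (i + 1) M) := by
  refine subsingleton_of_forall_eq 0 fun z => ?_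
  obtain ⟨y, rfl⟩ := (exact₁ a i hf hg hfg z).mp (Subsingleton.elim _ _)
  exact (exact₃ a i hf hg hfg y).mpr (h0 y)

lemma map_surjective_iff (h1 : Subsingleton (ExtLC a (i + 1) N)) :
    Function.Surjective (map a i g) ↔ Subsingleton (ExtLC a (i + 1) M) :=
  ⟨fun h => subsingleton_left_of_surjective hf hg hfg h h1, fun h => map_surjective hf hg hfg h⟩

end Exact

lemma subsingleton_of_injective (J : Type u) [AddCommGroup J] [Module A J] [Module.Injective A J] :
    Subsingleton (ExtLC a (i + 1) J) := by
  refine subsingleton_of_forall_eq 0 fun z => ?_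
  obtain ⟨n, e, rfl⟩ := exists_of z
  have : Injective (ModuleCat.of A J) := Module.injective_object_of_injective_module A J
  rw [Ext.eq_zero_of_injective e, map_zero]

end ExtLC

/-- Every module embeds in an injective module. -/
lemma exists_injective_module (A : Type u) [CommRing A] (M : Type u) [AddCommGroup M]
    [Module A M] : ∃ (J : Type u) (_ : AddCommGroup J) (_ : Module A J) (f : M →ₗ[A] J),
      Module.Injective A J ∧ Function.Injective f := by
  have h : Injective (ModuleCat.of A (Injective.under (ModuleCat.of A M) : ModuleCat.{u} A)) :=
    inferInstanceAs (Injective (Injective.under (ModuleCat.of A M)))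
  exact ⟨(Injective.under (ModuleCat.of A M) : ModuleCat.{u} A), inferInstance, inferInstance,
    (Injective.ι (ModuleCat.of A M)).hom, Module.injective_module_of_injective_object A _,
    (ModuleCat.mono_iff_injective _).mp inferInstance⟩

/-- Over a Noetherian ring the torsion submodule of an injective module is injective. -/
lemma injective_powTorsion {A : Type u} [CommRing A] [IsNoetherianRing A] (a : Ideal A)
    (J : Type u) [AddCommGroup J] [Module A J] [Module.Injective A J] :
    Module.Injective A (powTorsion a J) := by
  apply Module.Baer.injective
  intro I g
  have hg : powTorsion a (LinearMap.range g) = ⊤ := by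
    refine eq_top_iff.mpr ?_
    rintro ⟨_, x, rfl⟩ -
    obtain ⟨n, hn⟩ := (g x).2
    exact ⟨n, fun r hr => Subtype.ext (Subtype.ext (hn r hr))⟩
  obtain ⟨n, hn⟩ := exists_pow_smul_eq_zero_of_finite hg
  obtain ⟨k, hk⟩ := Ideal.exists_pow_inf_eq_pow_smul (I := a) (M := A) I
  let φ : I →ₗ[A] A ⧸ a ^ (n + k) := (a ^ (n + k)).mkQ ∘ₗ I.subtype
  have hφ : LinearMap.ker φ ≤ LinearMap.ker ((powTorsion a J).subtype ∘ₗ g) := by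
    intro x hx
    have hx1 : (x : A) ∈ a ^ (n + k) • (⊤ : Submodule A A) ⊓ I := by
      refine ⟨?_, x.2⟩
      rw [smul_eq_mul, Ideal.mul_top]
      exact (Submodule.Quotient.mk_eq_zero _).mp hx
    rw [hk (n + k) (by omega), Nat.add_sub_cancel] at hx1
    have hx2 : (x : A) ∈ a ^ n • (I : Submodule A A) :=
      Submodule.smul_mono le_rfl inf_le_right hx1
    have hx3 : x ∈ a ^ n • (⊤ : Submodule A I) := by
      have hx2 : (x : A) ∈ Submodule.map I.subtype (a ^ n • (⊤ : Submodule A I)) := by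
        rwa [Submodule.map_smul'', Submodule.map_subtype_top]
      obtain ⟨y, hy, hyx⟩ := hx2
      rwa [← Subtype.ext hyx]
    have hx4 : g x = 0 := by
      refine Submodule.smul_induction_on hx3 (fun r hr y _ => ?_) (fun y z hy hz => ?_)
      · rw [map_smul]
        exact congrArg Subtype.val (hn r hr ⟨g y, y, rfl⟩)
      · rw [map_add, hy, hz, add_zero]
    simp [hx4]
  obtain ⟨h, hh⟩ := Module.Injective.out (R := A) (Q := J) ((LinearMap.ker φ).liftQ φ le_rfl)
    (LinearMap.ker_eq_bot.mp (Submodule.ker_liftQ_eq_bot' _ _ rfl))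
    ((LinearMap.ker φ).liftQ _ hφ)
  refine ⟨LinearMap.codRestrict _ (h ∘ₗ (a ^ (n + k)).mkQ) ?_, ?_⟩
  · intro x
    refine ⟨n + k, fun r hr => ?_⟩
    rw [← map_smul]
    have : (a ^ (n + k)).mkQ (r • x) = 0 := by
      rw [Submodule.mkQ_apply, Submodule.Quotient.mk_eq_zero]
      exact Ideal.mul_mem_right _ _ hr
    rw [LinearMap.comp_apply, this, map_zero]
  · intro x hx
    apply Subtype.ext
    exact hh (Submodule.Quotient.mk ⟨x, hx⟩)

namespace ExtLC

lemma subsingleton_of_powTorsion_eq_top {A : Type u} [CommRing A] [IsNoetherianRing A]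
    {a : Ideal A} (i : ℕ) : ∀ (M : Type u) [AddCommGroup M] [Module A M]
    (_ : powTorsion a M = ⊤), Subsingleton (ExtLC a (i + 1) M) := by
  induction i with
  | zero =>
    intro M _ _ hM
    obtain ⟨J, _, _, f, hJ, hf⟩ := exists_injective_module A M
    have hfT (x : M) : f x ∈ powTorsion a J :=
      map_mem_powTorsion f (by rw [hM]; trivial)
    have := injective_powTorsion a J
    let f' : M →ₗ[A] powTorsion a J := f.codRestrict _ hfT
    have hf' : Function.Injective f' := fun x y h => hf (congrArg Subtype.val h)
    refine subsingleton_left_of_surjective hf' (LinearMap.range f').mkQ_surjective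
      (LinearMap.exact_map_mkQ_range f') ?_ (subsingleton_of_injective (powTorsion a J))
    rw [map_zero_surjective_iff]
    rintro y -
    obtain ⟨x, rfl⟩ := (LinearMap.range f').mkQ_surjective y
    obtain ⟨n, hn⟩ := x.2
    exact ⟨x, ⟨n, fun r hr => Subtype.ext (hn r hr)⟩, rfl⟩
  | succ i ih =>
    intro M _ _ hM
    obtain ⟨J, _, _, f, hJ, hf⟩ := exists_injective_module A M
    have hfT (x : M) : f x ∈ powTorsion a J :=
      map_mem_powTorsion f (by rw [hM]; trivial)
    have := injective_powTorsion a J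
    let f' : M →ₗ[A] powTorsion a J := f.codRestrict _ hfT
    have hf' : Function.Injective f' := fun x y h => hf (congrArg Subtype.val h)
    refine subsingleton_left hf' (LinearMap.range f').mkQ_surjective
      (LinearMap.exact_map_mkQ_range f') (ih _ ?_) (subsingleton_of_injective (powTorsion a J))
    refine eq_top_iff.mpr fun y _ => ?_
    obtain ⟨x, rfl⟩ := (LinearMap.range f').mkQ_surjective y
    obtain ⟨n, hn⟩ := x.2
    exact map_mem_powTorsion _ ⟨n, fun r hr => Subtype.ext (hn r hr)⟩

end ExtLC

namespace ExtLC
open Abelian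

/-- Over a Noetherian ring, `Ext Y - i` for finite `Y` has a versal class into a finite module. -/
lemma exists_versal_ext {A : Type u} [CommRing A] [IsNoetherianRing A] (i : ℕ) :
    ∀ (Y : Type u) [AddCommGroup Y] [Module A Y] [Module.Finite A Y],
    ∃ (Z : Type u) (_ : AddCommGroup Z) (_ : Module A Z) (_ : Module.Finite A Z)
      (ε : Ext (ModuleCat.of A Y) (ModuleCat.of A Z) i),
      ∀ (X : Type u) [AddCommGroup X] [Module A X] (e : Ext (ModuleCat.of A Y) (ModuleCat.of A X) i),
        ∃ f : Z →ₗ[A] X, e = ε.comp (Ext.mk₀ (ModuleCat.ofHom f)) (add_zero i) := by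
  induction i with
  | zero =>
    intro Y _ _ _
    refine ⟨Y, inferInstance, inferInstance, inferInstance, Ext.mk₀ (𝟙 _), fun X _ _ e => ?_⟩
    obtain ⟨f, rfl⟩ := Ext.homEquiv₀.symm.surjective e
    exact ⟨f.hom, by simp⟩
  | succ i ih =>
    intro Y _ _ _
    obtain ⟨n, π, hπ⟩ := Module.Finite.exists_fin' A Y
    have hS := shortExact_moduleCat (LinearMap.ker π).injective_subtype hπ
      (LinearMap.exact_subtype_ker_map π)
    have hproj : Projective (ModuleCat.of A (Fin n → A)) :=
      (IsProjective.iff_projective (R := A) (Fin n → A)).mp inferInstance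
    obtain ⟨Z, _, _, _, ε, hε⟩ := ih (LinearMap.ker π)
    refine ⟨Z, inferInstance, inferInstance, inferInstance,
      hS.extClass.comp ε (add_comm 1 i), fun X _ _ e => ?_⟩
    obtain ⟨e', rfl⟩ := Ext.contravariant_sequence_exact₃ hS (ModuleCat.of A X) e
      (Ext.eq_zero_of_projective (P := ModuleCat.of A (Fin n → A)) _) (add_comm 1 i)
    obtain ⟨f, rfl⟩ := hε X e'
    exact ⟨f, by rw [Ext.comp_assoc_of_third_deg_zero]⟩

variable {A : Type u} [CommRing A] [IsNoetherianRing A] {a : Ideal A} {i : ℕ}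
variable {M : Type u} [AddCommGroup M] [Module A M]
variable {N : Type u} [AddCommGroup N] [Module A N]
variable {P : Type u} [AddCommGroup P] [Module A P]

lemma exists_finite_map_eq (z : ExtLC a i M) :
    ∃ (Z : Type u) (_ : AddCommGroup Z) (_ : Module A Z) (_ : Module.Finite A Z)
      (f : Z →ₗ[A] M) (w : ExtLC a i Z), map a i f w = z := by
  obtain ⟨n, e, rfl⟩ := exists_of z
  obtain ⟨Z, _, _, _, ε, hε⟩ := exists_versal_ext (A := A) i (A ⧸ a ^ n)
  obtain ⟨f, rfl⟩ := hε M e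
  exact ⟨Z, inferInstance, inferInstance, inferInstance, f, of a i Z n ε, map_of _ _⟩

lemma exists_fg_map_subtype_eq (z : ExtLC a i M) :
    ∃ (M' : Submodule A M) (_ : M'.FG) (w : ExtLC a i M'), map a i M'.subtype w = z := by
  obtain ⟨Z, _, _, _, f, w, rfl⟩ := exists_finite_map_eq z
  refine ⟨LinearMap.range f, Module.Finite.iff_fg.mp inferInstance,
    map a i f.rangeRestrict w, ?_⟩
  rw [map_comp_apply]
  rfl

lemma map_injective_of_pure {f : M →ₗ[A] N} {g : N →ₗ[A] P} (hf : Function.Injective f)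
    (hg : Function.Surjective g) (hfg : Function.Exact f g)
    (hlift : ∀ (Z : Type u) [AddCommGroup Z] [Module A Z] [Module.Finite A Z] (h : Z →ₗ[A] P),
      ∃ h' : Z →ₗ[A] N, g ∘ₗ h' = h) : Function.Injective (map a i f) := by
  cases i with
  | zero => exact map_zero_injective hf
  | succ i =>
    rw [injective_iff_map_eq_zero]
    intro z hz
    obtain ⟨y, rfl⟩ := (exact₁ a i hf hg hfg z).mp hz
    obtain ⟨Z, _, _, _, h, w, rfl⟩ := exists_finite_map_eq y
    obtain ⟨h', rfl⟩ := hlift Z h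
    rw [← map_comp_apply]
    exact (exact₃ a i hf hg hfg _).mpr ⟨_, rfl⟩

end ExtLC

/-- A linear system over `M` solvable after a faithfully flat base change is solvable. -/
lemma exists_solution_of_faithfullyFlat {A S M : Type*} [CommRing A] [CommRing S] [Algebra A S]
    [Module.FaithfullyFlat A S] [AddCommGroup M] [Module A M] {n r : ℕ}
    (b : Fin r → Fin n → A) (m : Fin r → M) (y : Fin n → S ⊗[A] M)
    (h : ∀ k, ∑ j, b k j • y j = 1 ⊗ₜ m k) : ∃ x : Fin n → M, ∀ k, ∑ j, b k j • x j = m k := by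
  classical
  let L : (Fin n → M) →ₗ[A] (Fin r → M) :=
    LinearMap.pi fun k => ∑ j, b k j • LinearMap.proj j
  let c := (LinearMap.range L).mkQ
  let e := TensorProduct.piRight A A S (fun _ : Fin r => M)
  let e' := TensorProduct.piRight A A S (fun _ : Fin n => M)
  have key (w : S ⊗[A] (Fin n → M)) (k : Fin r) :
      e (L.lTensor S w) k = ∑ j, b k j • e' w j := by
    induction w with
    | zero => simp
    | add w w' h h' => simp only [map_add, Pi.add_apply, h, h', smul_add, Finset.sum_add_distrib]
    | tmul s x => simp [e, e', L, tmul_sum]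
  have h1 : L.lTensor S (e'.symm y) = 1 ⊗ₜ m := by
    apply e.injective
    ext k
    rw [key, e'.apply_symm_apply, h]
    simp [e]
  have h2 : (1 : S) ⊗ₜ[A] c m = 0 := by
    have : c.lTensor S (L.lTensor S (e'.symm y)) = 0 := by
      rw [← LinearMap.comp_apply, ← LinearMap.lTensor_comp, LinearMap.range_mkQ_comp]
      simp
    simpa [h1] using this
  have h3 : c m = 0 :=
    Module.FaithfullyFlat.tensorProduct_mk_injective (A := A) (B := S) _ (by simpa using h2)
  obtain ⟨x, hx⟩ := (Submodule.Quotient.mk_eq_zero _).mp h3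
  refine ⟨x, fun k => ?_⟩
  rw [← hx]
  simp [L]

lemma exists_lift_of_faithfullyFlat {A S M : Type u} [CommRing A] [IsNoetherianRing A]
    [CommRing S] [Algebra A S]
    [Module.FaithfullyFlat A S] [AddCommGroup M] [Module A M] (Z : Type u)
    [AddCommGroup Z] [Module A Z] [Module.Finite A Z]
    (h : Z →ₗ[A] (S ⊗[A] M) ⧸ LinearMap.range (TensorProduct.mk A S M 1)) :
    ∃ h' : Z →ₗ[A] S ⊗[A] M, (LinearMap.range (TensorProduct.mk A S M 1)).mkQ ∘ₗ h' = h := by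
  obtain ⟨n, π, hπ⟩ := Module.Finite.exists_fin' A Z
  obtain ⟨r, b, hb⟩ := Submodule.fg_iff_exists_fin_generating_family.mp
    (IsNoetherian.noetherian (LinearMap.ker π))
  have hy (j : Fin n) := (LinearMap.range (TensorProduct.mk A S M 1)).mkQ_surjective
    (h (π fun k => if j = k then 1 else 0))
  choose y hy using hy
  have hu (c : Fin n → A) : (LinearMap.range (TensorProduct.mk A S M 1)).mkQ
      (Fintype.linearCombination A y c) = h (π c) := by
    rw [LinearMap.pi_apply_eq_sum_univ π c, Fintype.linearCombination_apply]
    simp only [map_sum, map_smul, hy]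
  have hm (k : Fin r) : ∃ m : M, TensorProduct.mk A S M 1 m =
      Fintype.linearCombination A y (b k) := by
    have hbk : b k ∈ LinearMap.ker π := hb ▸ Submodule.subset_span ⟨k, rfl⟩
    have := hu (b k)
    rw [LinearMap.mem_ker.mp hbk, map_zero, Submodule.mkQ_apply, Submodule.Quotient.mk_eq_zero]
      at this
    exact this
  choose m hm using hm
  obtain ⟨x, hx⟩ := exists_solution_of_faithfullyFlat b m y fun k => by
    rw [← TensorProduct.mk_apply, hm, Fintype.linearCombination_apply]
  let v : (Fin n → A) →ₗ[A] S ⊗[A] M := Fintype.linearCombination A y -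
    TensorProduct.mk A S M 1 ∘ₗ Fintype.linearCombination A x
  have hv : LinearMap.ker π ≤ LinearMap.ker v := by
    rw [← hb, Submodule.span_le]
    rintro _ ⟨k, rfl⟩
    simp only [v, SetLike.mem_coe, LinearMap.mem_ker, LinearMap.sub_apply, LinearMap.comp_apply,
      ← hm]
    rw [Fintype.linearCombination_apply, hx, sub_self]
  refine ⟨(LinearMap.ker π).liftQ v hv ∘ₗ (π.quotKerEquivOfSurjective hπ).symm, ?_⟩
  ext z
  obtain ⟨c, rfl⟩ := hπ z
  have : (π.quotKerEquivOfSurjective hπ).symm (π c) = Submodule.Quotient.mk c := by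
    rw [LinearEquiv.symm_apply_eq]
    rfl
  simp only [LinearMap.comp_apply, LinearEquiv.coe_coe, this, Submodule.liftQ_apply, v,
    LinearMap.sub_apply, map_sub, hu]
  rw [sub_eq_self, Submodule.mkQ_apply, Submodule.Quotient.mk_eq_zero]
  exact ⟨_, rfl⟩

namespace ExtLC

/-- Local cohomology of `M` embeds in local cohomology of a faithfully flat base change. -/
lemma subsingleton_of_faithfullyFlat {A S M : Type u} [CommRing A] [IsNoetherianRing A]
    [CommRing S] [Algebra A S] [Module.FaithfullyFlat A S] [AddCommGroup M] [Module A M]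
    {a : Ideal A} {i : ℕ} (h : Subsingleton (ExtLC a i (S ⊗[A] M))) :
    Subsingleton (ExtLC a i M) :=
  (map_injective_of_pure (f := TensorProduct.mk A S M 1)
    (Module.FaithfullyFlat.tensorProduct_mk_injective M)
    (LinearMap.range (TensorProduct.mk A S M 1)).mkQ_surjective
    (LinearMap.exact_map_mkQ_range _)
    (fun Z _ _ _ h => exists_lift_of_faithfullyFlat Z h)).subsingleton

end ExtLC

/-- Restriction of scalars along a flat algebra preserves injective modules. -/
lemma injective_restrictScalars {A S J : Type u} [CommRing A] [CommRing S] [Algebra A S]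
    [Module.Flat A S] [AddCommGroup J] [Module A J] [Module S J] [IsScalarTower A S J]
    [Module.Injective S J] : Module.Injective A J := by
  refine ⟨fun X Y _ _ _ _ f hf g => ?_⟩
  obtain ⟨h, hh⟩ := Module.Injective.out (R := S) (Q := J) (f.baseChange S)
    (Module.Flat.lTensor_preserves_injective_linearMap (M := S) f hf) (g.liftBaseChange S)
  refine ⟨h.restrictScalars A ∘ₗ TensorProduct.mk A S Y 1, fun x => ?_⟩
  simpa using hh (1 ⊗ₜ x)

lemma mem_powTorsion_map_iff {A S N : Type*} [CommRing A] [CommRing S] [Algebra A S]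
    [AddCommGroup N] [Module A N] [Module S N] [IsScalarTower A S N] (a : Ideal A) (x : N) :
    x ∈ powTorsion (a.map (algebraMap A S)) N ↔ x ∈ powTorsion a N := by
  rw [mem_powTorsion, mem_powTorsion]
  refine exists_congr fun n => ⟨fun h r hr => ?_, fun h r hr => ?_⟩
  · rw [← algebraMap_smul S r x]
    refine h _ ?_
    rw [← Ideal.map_pow]
    exact Ideal.mem_map_of_mem _ hr
  · rw [← Ideal.map_pow] at hr
    have hle : (a ^ n).map (algebraMap A S) ≤ LinearMap.ker (LinearMap.toSpanSingleton S N x) := by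
      rw [Ideal.map_le_iff_le_comap]
      intro s hs
      simpa using h s hs
    simpa using hle hr

namespace ExtLC

lemma subsingleton_map_iff {A S : Type u} [CommRing A] [CommRing S] [Algebra A S]
    [Module.Flat A S] (a : Ideal A) (i : ℕ) :
    ∀ (N : Type u) [AddCommGroup N] [Module A N] [Module S N] [IsScalarTower A S N],
      Subsingleton (ExtLC a i N) ↔ Subsingleton (ExtLC (a.map (algebraMap A S)) i N) := by
  induction i with
  | zero =>
    intro N _ _ _ _
    simp only [subsingleton_zero_iff, Submodule.eq_bot_iff, mem_powTorsion_map_iff]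
  | succ i ih =>
    intro N _ _ _ _
    obtain ⟨J, _, _, f, hJ, hf⟩ := exists_injective_module S N
    let _ : Module A J := Module.compHom J (algebraMap A S)
    have : IsScalarTower A S J := IsScalarTower.of_algebraMap_smul fun _ _ => rfl
    have hJ' : Module.Injective A J := injective_restrictScalars (S := S)
    have hg := (LinearMap.range f).mkQ_surjective
    have hfg := LinearMap.exact_map_mkQ_range f
    cases i with
    | zero =>
      rw [← map_surjective_iff (f := f) hf hg hfg (subsingleton_of_injective J),
        ← map_surjective_iff (f := f.restrictScalars A)
          (g := (LinearMap.range f).mkQ.restrictScalars A) hf hg hfg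
          (subsingleton_of_injective J), map_zero_surjective_iff, map_zero_surjective_iff]
      simp only [mem_powTorsion_map_iff]
      rfl
    | succ i =>
      have key := ih (J ⧸ LinearMap.range f)
      constructor
      · intro h
        exact subsingleton_left (f := f) hf hg hfg (key.mp
          (subsingleton_right (f := f.restrictScalars A)
            (g := (LinearMap.range f).mkQ.restrictScalars A) hf hg hfg
            (subsingleton_of_injective J) h)) (subsingleton_of_injective J)
      · intro h
        exact subsingleton_left (f := f.restrictScalars A)
          (g := (LinearMap.range f).mkQ.restrictScalars A) hf hg hfg (key.mpr
          (subsingleton_right (f := f) hf hg hfg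
            (subsingleton_of_injective J) h)) (subsingleton_of_injective J)

end ExtLC

/-- Dévissage of a finite module annihilated by `I` into quotients by primes containing `I`. -/
lemma induction_of_le_annihilator {A : Type u} [CommRing A] [IsNoetherianRing A] (I : Ideal A)
    (motive : (N : Type u) → [AddCommGroup N] → [Module A N] → Prop)
    (subsingleton : ∀ (N : Type u) [AddCommGroup N] [Module A N], Subsingleton N → motive N)
    (congr : ∀ (N N' : Type u) [AddCommGroup N] [Module A N] [AddCommGroup N'] [Module A N'],
      (N ≃ₗ[A] N') → motive N' → motive N)
    (quotient : ∀ q : Ideal A, q.IsPrime → I ≤ q → motive (A ⧸ q))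
    (exact : ∀ (N₁ N₂ N₃ : Type u) [AddCommGroup N₁] [Module A N₁] [AddCommGroup N₂] [Module A N₂]
      [AddCommGroup N₃] [Module A N₃] (f : N₁ →ₗ[A] N₂) (g : N₂ →ₗ[A] N₃),
      Function.Injective f → Function.Surjective g → Function.Exact f g →
      motive N₁ → motive N₃ → motive N₂)
    (M : Type u) [AddCommGroup M] [Module A M] (hM : Module.Finite A M)
    (hI : I ≤ Module.annihilator A M) : motive M := by
  refine IsNoetherianRing.induction_on_isQuotientEquivQuotientPrime A hM
    (motive := fun N _ _ _ => I ≤ Module.annihilator A N → motive N) ?_ ?_ ?_ hI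
  · intro N _ _ _ _ _
    exact subsingleton N ‹_›
  · intro N _ _ _ p e h
    refine congr _ _ e (quotient _ p.2 (h.trans ?_))
    rw [e.annihilator_eq, Ideal.annihilator_quotient]
  · intro N₁ _ _ _ N₂ _ _ _ N₃ _ _ _ f g hf hg hfg h₁ h₃ h
    exact exact _ _ _ f g hf hg hfg (h₁ (h.trans (f.annihilator_le_of_injective hf)))
      (h₃ (h.trans (g.annihilator_le_of_surjective hg)))

section PrimeQuotient

variable {A : Type u} [CommRing A]

lemma lsmul_quotient_injective {q : Ideal A} [q.IsPrime] {x : A} (hx : x ∉ q) :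
    Function.Injective (LinearMap.lsmul A (A ⧸ q) x) := by
  rw [injective_iff_map_eq_zero]
  intro y hy
  obtain ⟨y, rfl⟩ := Ideal.Quotient.mk_surjective y
  rw [LinearMap.lsmul_apply, Algebra.smul_def, Ideal.Quotient.algebraMap_eq, ← map_mul,
    Ideal.Quotient.eq_zero_iff_mem] at hy
  rw [Ideal.Quotient.eq_zero_iff_mem]
  exact (Ideal.IsPrime.mem_or_mem ‹_› hy).resolve_left hx

lemma exact_lsmul_factor (q : Ideal A) (x : A) :
    Function.Exact (LinearMap.lsmul A (A ⧸ q) x)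
      (Submodule.factor (le_sup_left : q ≤ q ⊔ Ideal.span {x})) := by
  intro y
  obtain ⟨y, rfl⟩ := Ideal.Quotient.mk_surjective y
  have : Submodule.factor (le_sup_left : q ≤ q ⊔ Ideal.span {x}) (Ideal.Quotient.mk q y) =
      Ideal.Quotient.mk (q ⊔ Ideal.span {x}) y := rfl
  rw [this, Ideal.Quotient.eq_zero_iff_mem, sup_comm, Ideal.mem_span_singleton_sup]
  constructor
  · rintro ⟨c, b, hb, rfl⟩
    refine ⟨Ideal.Quotient.mk q c, ?_⟩
    rw [LinearMap.lsmul_apply, Algebra.smul_def, Ideal.Quotient.algebraMap_eq, map_add, map_mul,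
      Ideal.Quotient.eq_zero_iff_mem.mpr hb, add_zero, mul_comm]
  · rintro ⟨z, hz⟩
    obtain ⟨z, rfl⟩ := Ideal.Quotient.mk_surjective z
    rw [LinearMap.lsmul_apply, Algebra.smul_def, Ideal.Quotient.algebraMap_eq, ← map_mul,
      Ideal.Quotient.mk_eq_mk_iff_sub_mem] at hz
    exact ⟨z, y - x * z, by rw [← neg_sub]; exact q.neg_mem hz, by ring⟩

lemma ringKrullDim_quotient_add_one_le {q q' : Ideal A} [q.IsPrime] (h : q < q') :
    ringKrullDim (A ⧸ q') + 1 ≤ ringKrullDim (A ⧸ q) := by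
  obtain ⟨x, hx, hxq⟩ := SetLike.exists_of_lt h
  refine ringKrullDim_succ_le_of_surjective (Ideal.Quotient.factor h.le)
    (Ideal.Quotient.factor_surjective h.le) (r := Ideal.Quotient.mk q x) ?_ ?_
  · rw [mem_nonZeroDivisors_iff_ne_zero]
    simpa [Ideal.Quotient.eq_zero_iff_mem] using hxq
  · simpa [Ideal.Quotient.eq_zero_iff_mem] using hx

lemma WithBot.lt_of_add_one_le_of_lt_succ {x y : WithBot ℕ∞} {n : ℕ} (h : x + 1 ≤ y)
    (h' : y < ((n + 1 : ℕ) : WithBot ℕ∞)) : x < (n : WithBot ℕ∞) := by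
  have h2 := h.trans_lt h'
  induction x with
  | bot => exact WithBot.bot_lt_coe _
  | coe x =>
    induction x with
    | top => exact absurd h2 (not_lt.mpr (le_top (α := WithBot ℕ∞)))
    | coe x =>
      norm_cast at h2 ⊢
      simpa using h2

end PrimeQuotient

namespace ExtLC

variable {A : Type u} [CommRing A] {a : Ideal A}

/-- An element `x ∉ q` whose quotient has vanishing cohomology in degree `i` acts
injectively on cohomology of `A ⧸ q` in degree `i + 1`. -/
lemma smul_injective_quotient {q : Ideal A} [q.IsPrime] {x : A} (hx : x ∉ q) {i : ℕ}
    (h : Subsingleton (ExtLC a i (A ⧸ (q ⊔ Ideal.span {x})))) :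
    ∀ z : ExtLC a (i + 1) (A ⧸ q), x • z = 0 → z = 0 := by
  have := map_injective_of_subsingleton (a := a) (i := i) (lsmul_quotient_injective hx)
    (Submodule.factor_surjective (le_sup_left : q ≤ q ⊔ Ideal.span {x}))
    (exact_lsmul_factor q x) h
  intro z hz
  apply this
  rw [map_lsmul_apply, map_zero, hz]

/-- Grothendieck vanishing. -/
lemma subsingleton_of_ringKrullDim_lt [IsNoetherianRing A] (a : Ideal A) (i : ℕ) :
    ∀ (I : Ideal A) (_ : ∀ q : Ideal A, q.IsPrime → I ≤ q → ringKrullDim (A ⧸ q) < i)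
      (M : Type u) [AddCommGroup M] [Module A M] (_ : Module.Finite A M)
      (_ : I ≤ Module.annihilator A M), Subsingleton (ExtLC a i M) := by
  induction i with
  | zero =>
    intro I h M _ _ hM hI
    rw [subsingleton_zero_iff, Submodule.eq_bot_iff]
    intro x _
    have : Subsingleton M := by
      rw [← Module.annihilator_eq_top_iff (R := A)]
      by_contra hne
      obtain ⟨m, hm, hle⟩ := Ideal.exists_le_maximal _ hne
      have := h m hm.isPrime (hI.trans hle)
      have h2 : 0 ≤ ringKrullDim (A ⧸ m) := ringKrullDim_nonneg_of_nontrivial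
      exact absurd (h2.trans_lt this) (by simp)
    exact Subsingleton.elim _ _
  | succ i ih =>
    intro I h M _ _ hM hI
    refine induction_of_le_annihilator I (fun N _ _ => Subsingleton (ExtLC a (i + 1) N))
      ?_ ?_ ?_ ?_ M hM hI
    · intro N _ _ _
      refine subsingleton_of_powTorsion_eq_top i N (eq_top_iff.mpr fun x _ => ?_)
      rw [Subsingleton.elim x 0]
      exact zero_mem _
    · intro N N' _ _ _ _ e h
      exact (subsingleton_congr e).mpr h
    · intro q hq hIq
      by_cases haq : a ≤ q
      · exact subsingleton_of_powTorsion_eq_top i _ (powTorsion_eq_top_of_le_annihilator fun r hr x =>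
          Module.mem_annihilator.mp ((haq.trans_eq Ideal.annihilator_quotient.symm) hr) x)
      · obtain ⟨x, hxa, hxq⟩ := SetLike.not_le_iff_exists.mp haq
        refine subsingleton_of_injective_smul hxa (smul_injective_quotient hxq ?_)
        refine ih (q ⊔ Ideal.span {x}) (fun q' hq' hle => ?_) _ inferInstance
          (by rw [Ideal.annihilator_quotient])
        have hlt : q < q' := lt_of_le_of_ne (le_sup_left.trans hle) fun he =>
          hxq (he ▸ hle (Ideal.mem_sup_right (Ideal.mem_span_singleton_self x)))
        exact WithBot.lt_of_add_one_le_of_lt_succ (ringKrullDim_quotient_add_one_le hlt)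
          (h q hq hIq)
    · intro N₁ N₂ N₃ _ _ _ _ _ _ f g hf hg hfg h₁ h₃
      exact subsingleton_mid hf hg hfg h₁ h₃

end ExtLC

section Opposite

variable {R : Type u} [Ring R] (K : ChainComplex (ModuleCat.{u} R)ᵒᵖ ℕ) (n : ℕ)

lemma unop_homologyι_surjective : Function.Surjective (K.homologyι n).unop.hom := by
  rw [← ModuleCat.epi_iff_surjective]
  infer_instance

lemma unop_pOpcycles_injective : Function.Injective (K.pOpcycles n).unop.hom := by
  rw [← ModuleCat.mono_iff_injective]
  infer_instance

lemma exact_unop_fromOpcycles_homologyι (j : ℕ) (hj : (ComplexShape.down ℕ).next n = j) :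
    Function.Exact (K.fromOpcycles n j).unop.hom (K.homologyι n).unop.hom := by
  have h : (ShortComplex.mk _ _ (K.homologyι_comp_fromOpcycles n j)).Exact :=
    ShortComplex.exact_of_f_is_kernel _ (K.homologyIsKernel n j hj)
  exact (ShortComplex.ShortExact.moduleCat_exact_iff_function_exact _).mp h.unop

lemma exact_unop_pOpcycles_d :
    Function.Exact (K.pOpcycles n).unop.hom (K.d (n + 1) n).unop.hom := by
  have h : (ShortComplex.mk _ _ (K.d_pOpcycles (n + 1) n)).Exact :=
    ShortComplex.exact_of_g_is_cokernel _ (K.opcyclesIsCokernel (n + 1) n (by simp))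
  exact (ShortComplex.ShortExact.moduleCat_exact_iff_function_exact _).mp h.unop

end Opposite

section DerivedExt

variable {R : Type u} [CommRing R] {X X' : ModuleCat.{u} R}

/-- The contravariant functor `Hom(-, Y)`, with values in the opposite category. -/
noncomputable abbrev homOp (Y : ModuleCat.{u} R) : ModuleCat.{u} R ⥤ (ModuleCat.{u} R)ᵒᵖ :=
  ((linearYoneda R (ModuleCat.{u} R)).obj Y).rightOp

/-- The complex `Hom(P, Y)`, as a chain complex in the opposite category. -/
noncomputable abbrev homOpComplex (P : ProjectiveResolution X) (Y : ModuleCat.{u} R) :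
    ChainComplex (ModuleCat.{u} R)ᵒᵖ ℕ :=
  ((homOp Y).mapHomologicalComplex (ComplexShape.down ℕ)).obj P.complex

/-- The map from cocycles of `Hom(P, Y)` to the derived functor `Ext`. -/
noncomputable def cocycleToExt (P : ProjectiveResolution X) (Y : ModuleCat.{u} R) (n : ℕ) :
    Opposite.unop ((homOpComplex P Y).opcycles n) ⟶
      ((Ext R (ModuleCat.{u} R) n).obj (Opposite.op X)).obj Y :=
  ((homOpComplex P Y).homologyι n).unop ≫ (P.isoLeftDerivedObj (homOp Y) n).hom.unop

/-- The class `z` in the derived functor `Ext` is represented by the cocycle `f`. -/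
def IsRepBy (P : ProjectiveResolution X) {Y : ModuleCat.{u} R} {n : ℕ} (f : P.complex.X n ⟶ Y)
    (z : ((Ext R (ModuleCat.{u} R) n).obj (Opposite.op X)).obj Y) : Prop :=
  ∃ w : (Opposite.unop ((homOpComplex P Y).opcycles n) : ModuleCat.{u} R),
    ((homOpComplex P Y).pOpcycles n).unop.hom w = f ∧ (cocycleToExt P Y n).hom w = z

variable {P : ProjectiveResolution X} {Y : ModuleCat.{u} R} {n : ℕ}

lemma exists_isRepBy (P : ProjectiveResolution X)
    (z : ((Ext R (ModuleCat.{u} R) n).obj (Opposite.op X)).obj Y) :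
    ∃ f : P.complex.X n ⟶ Y, P.complex.d (n + 1) n ≫ f = 0 ∧ IsRepBy P f z := by
  obtain ⟨y, hy⟩ : ∃ y, (P.isoLeftDerivedObj (homOp Y) n).hom.unop.hom y = z :=
    ((ModuleCat.epi_iff_surjective (P.isoLeftDerivedObj (homOp Y) n).hom.unop).mp inferInstance) z
  obtain ⟨w, rfl⟩ := unop_homologyι_surjective (homOpComplex P Y) n y
  refine ⟨((homOpComplex P Y).pOpcycles n).unop.hom w, ?_, w, rfl, hy⟩
  exact (exact_unop_pOpcycles_d (homOpComplex P Y) n _).mpr ⟨w, rfl⟩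

lemma IsRepBy.exists (f : P.complex.X n ⟶ Y) (hf : P.complex.d (n + 1) n ≫ f = 0) :
    ∃ z, IsRepBy P f z := by
  obtain ⟨w, hw⟩ := (exact_unop_pOpcycles_d (homOpComplex P Y) n f).mp hf
  exact ⟨_, w, hw, rfl⟩

lemma IsRepBy.eq_zero_iff {f : P.complex.X n ⟶ Y}
    {z : ((Ext R (ModuleCat.{u} R) n).obj (Opposite.op X)).obj Y} (h : IsRepBy P f z)
    (j : ℕ) (hj : (ComplexShape.down ℕ).next n = j) :
    z = 0 ↔ ∃ g : P.complex.X j ⟶ Y, P.complex.d n j ≫ g = f := by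
  obtain ⟨w, rfl, rfl⟩ := h
  have hinj : Function.Injective (P.isoLeftDerivedObj (homOp Y) n).hom.unop.hom :=
    (ModuleCat.mono_iff_injective (P.isoLeftDerivedObj (homOp Y) n).hom.unop).mp inferInstance
  have h1 : (cocycleToExt P Y n).hom w = 0 ↔ ((homOpComplex P Y).homologyι n).unop.hom w = 0 :=
    map_eq_zero_iff _ hinj
  have h2 (g : P.complex.X j ⟶ Y) : ((homOpComplex P Y).pOpcycles n).unop.hom
      (((homOpComplex P Y).fromOpcycles n j).unop.hom g) = P.complex.d n j ≫ g := by
    have := (homOpComplex P Y).p_fromOpcycles n j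
    exact congr($(congr(Quiver.Hom.unop $this)).hom g)
  rw [h1, exact_unop_fromOpcycles_homologyι (homOpComplex P Y) n j hj w]
  constructor
  · rintro ⟨g, rfl⟩
    exact ⟨g, (h2 g).symm⟩
  · rintro ⟨g, hg⟩
    refine ⟨g, unop_pOpcycles_injective (homOpComplex P Y) n ?_⟩
    rw [h2]
    exact hg

lemma IsRepBy.map {f : P.complex.X n ⟶ Y}
    {z : ((Ext R (ModuleCat.{u} R) n).obj (Opposite.op X)).obj Y} (h : IsRepBy P f z)
    {P' : ProjectiveResolution X'} {g : X' ⟶ X} (φ : P'.Hom P g) :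
    IsRepBy P' (φ.hom.f n ≫ f) ((((Ext R (ModuleCat.{u} R) n).map g.op).app Y).hom z) := by
  obtain ⟨w, rfl, rfl⟩ := h
  let ψ : homOpComplex P' Y ⟶ homOpComplex P Y :=
    ((homOp Y).mapHomologicalComplex (ComplexShape.down ℕ)).map φ.hom
  refine ⟨(HomologicalComplex.opcyclesMap ψ n).unop.hom w, ?_, ?_⟩
  · have := HomologicalComplex.p_opcyclesMap ψ n
    exact congr($(congr(Quiver.Hom.unop $this)).hom w)
  · have h1 := ProjectiveResolution.isoLeftDerivedObj_hom_naturality g P' P φ.hom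
      (by simpa using φ.hom_f_zero_comp_π_f_zero) (homOp Y) n
    have h2 := HomologicalComplex.homologyι_naturality ψ n
    have h3 : ((homOp Y).leftDerived n).map g ≫ (P.isoLeftDerivedObj (homOp Y) n).hom ≫
        (homOpComplex P Y).homologyι n = (P'.isoLeftDerivedObj (homOp Y) n).hom ≫
          (homOpComplex P' Y).homologyι n ≫ HomologicalComplex.opcyclesMap ψ n :=
      (Category.assoc _ _ _).symm.trans ((congrArg (· ≫ (homOpComplex P Y).homologyι n) h1).trans
        ((Category.assoc _ _ _).trans
          (congrArg ((P'.isoLeftDerivedObj (homOp Y) n).hom ≫ ·) h2)))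
    exact (congr($(congr(Quiver.Hom.unop $h3)).hom w)).symm

end DerivedExt

lemma CategoryTheory.ProjectiveResolution.extMk_eq_zero_iff' {R : Type u} [CommRing R]
    {X Y : ModuleCat.{u} R}
    (P : ProjectiveResolution X) {n : ℕ} (f : P.complex.X n ⟶ Y)
    (hf : P.complex.d (n + 1) n ≫ f = 0) (j : ℕ) (hj : (ComplexShape.down ℕ).next n = j) :
    P.extMk f (n + 1) rfl hf = 0 ↔ ∃ g : P.complex.X j ⟶ Y, P.complex.d n j ≫ g = f := by
  cases n with
  | succ n =>
    obtain rfl : n = j := by simpa using hj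
    exact P.extMk_eq_zero_iff f _ rfl hf n rfl
  | zero =>
    have hd : P.complex.d 0 j = 0 := P.complex.shape _ _ (by simp)
    simp only [hd, Limits.zero_comp, exists_const_iff]
    rw [← P.extEquivCohomologyClass.apply_eq_iff_eq,
      ProjectiveResolution.extEquivCohomologyClass_extMk,
      ProjectiveResolution.extEquivCohomologyClass_zero,
      CochainComplex.HomComplex.CohomologyClass.mk_eq_zero_iff,
      CochainComplex.HomComplex.Cocycle.toSingleMk_mem_coboundaries_iff _ _ _ _ _ 1 (by lia)]
    have : Limits.IsZero (P.cochainComplex.X 1) := P.cochainComplex.isZero_of_isStrictlyLE 0 1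
    constructor
    · rintro ⟨g, hg⟩
      refine ⟨⟨0⟩, ?_⟩
      rw [this.eq_of_src g 0, Limits.comp_zero] at hg
      exact ((Preadditive.IsIso.comp_left_eq_zero _ _).mp hg.symm).symm
    · rintro ⟨-, rfl⟩
      exact ⟨0, by simp⟩

namespace ExtLC

open Abelian Opposite localCohomology

variable {A : Type} [CommRing A] (a : Ideal A) (i : ℕ)

/-- The directed system computing `localCohomology a i` at `M`. -/
noncomputable abbrev derivedDiagram (M : ModuleCat.{0} A) : (ℕᵒᵖ)ᵒᵖ ⥤ ModuleCat.{0} A :=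
  diagram (idealPowersDiagram a) i ⋙ (evaluation _ _).obj M

/-- `localCohomology a i` evaluated at `M` as a colimit cocone. -/
noncomputable abbrev derivedCocone (M : ModuleCat.{0} A) : Limits.Cocone (derivedDiagram a i M) :=
  ((evaluation _ _).obj M).mapCocone (Limits.colimit.cocone (diagram (idealPowersDiagram a) i))

/-- The cocone `derivedCocone` is colimiting. -/
noncomputable def isColimitDerivedCocone (M : ModuleCat.{0} A) :
    Limits.IsColimit (derivedCocone a i M) :=
  Limits.isColimitOfPreserves _ (Limits.colimit.isColimit _)

lemma exists_hom (n m : ℕ) (h : n ≤ m) (P : ∀ n, ProjectiveResolution (ModuleCat.of A (A ⧸ a ^ n))) :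
    Nonempty ((P m).Hom (P n) (powQuotMap a h)) :=
  ⟨⟨ProjectiveResolution.lift (powQuotMap a h) (P m) (P n), by
    simpa using ProjectiveResolution.lift_commutes_zero (powQuotMap a h) (P m) (P n)⟩⟩

/-- The two models of local cohomology, through derived functors of `Hom(-, M)` and through
the derived category, vanish simultaneously. -/
lemma subsingleton_localCohomology_iff (M : Type) [AddCommGroup M] [Module A M] :
    Subsingleton ((localCohomology a i).obj (ModuleCat.of A M)) ↔ Subsingleton (ExtLC a i M) := by
  let P n : ProjectiveResolution (ModuleCat.of A (A ⧸ a ^ n)) := projectiveResolution _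
  have hcol := isColimitDerivedCocone a i (ModuleCat.of A M)
  constructor
  · intro hs
    refine subsingleton_of_forall_eq 0 fun z => ?_
    obtain ⟨n, e, rfl⟩ := exists_of z
    obtain ⟨f, hf, rfl⟩ := (P n).extMk_surjective e _ rfl
    obtain ⟨z', hz'⟩ := IsRepBy.exists f hf
    let z'' : (derivedDiagram a i (ModuleCat.of A M)).obj (op (op n)) := z'
    obtain ⟨k, s, t, hst⟩ := (Limits.Concrete.isColimit_rep_eq_iff_exists _ hcol z''
      (0 : (derivedDiagram a i (ModuleCat.of A M)).obj (op (op n)))).mp (hs.elim _ _)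
    rw [map_zero] at hst
    have hnk : n ≤ k.unop.unop := leOfHom s.unop.unop
    obtain ⟨φ⟩ := exists_hom a n k.unop.unop hnk P
    have hrep := hz'.map φ
    obtain ⟨g, hg⟩ := (hrep.eq_zero_iff _ rfl).mp hst
    rw [of_eq_zero_iff]
    refine ⟨_, hnk, ?_⟩
    rw [ProjectiveResolution.mk₀_comp_extMk _ _ _ _ φ,
      ProjectiveResolution.extMk_eq_zero_iff' _ _ _ _ rfl]
    exact ⟨g, hg⟩
  · intro hs
    refine subsingleton_of_forall_eq 0 fun z => ?_
    obtain ⟨j, y, rfl⟩ := Limits.Concrete.isColimit_exists_rep _ hcol z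
    obtain ⟨f, hf, hrep⟩ := exists_isRepBy (P j.unop.unop) y
    obtain ⟨m, h, hm⟩ := (of_eq_zero_iff ((P j.unop.unop).extMk f _ rfl hf)).mp
      (Subsingleton.elim _ _)
    obtain ⟨φ⟩ := exists_hom a _ m h P
    rw [ProjectiveResolution.mk₀_comp_extMk _ _ _ _ φ,
      ProjectiveResolution.extMk_eq_zero_iff' _ _ _ _ rfl] at hm
    have h0 := ((hrep.map φ).eq_zero_iff _ rfl).mpr hm
    have key := (Limits.Concrete.isColimit_rep_eq_iff_exists _ hcol y
      (0 : (derivedDiagram a i (ModuleCat.of A M)).obj j)).mpr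
      ⟨op (op m), (homOfLE h).op.op, (homOfLE h).op.op, by rw [map_zero]; exact h0⟩
    exact key.trans (map_zero _)

end ExtLC

section InjectiveHull

variable {S : Type u} [CommRing S] {I : Type u} [AddCommGroup I] [Module S I]

/-- Every nonzero element of `E` has a nonzero multiple in `K`. -/
def IsEssentialOver (K E : Submodule S I) : Prop :=
  ∀ x ∈ E, x ≠ 0 → ∃ r : S, r • x ∈ K ∧ r • x ≠ 0

lemma exists_maximal_isEssentialOver (K : Submodule S I) :
    ∃ E : Submodule S I, K ≤ E ∧ Maximal (IsEssentialOver K) E := by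
  refine zorn_le_nonempty₀ {E | IsEssentialOver K E} (fun c hc hch y hy => ?_) K
    (fun x hx h0 => ⟨1, by simpa using hx, by simpa using h0⟩)
  refine ⟨sSup c, fun x hx => ?_, fun z hz => le_sSup hz⟩
  rw [Submodule.mem_sSup_of_directed ⟨y, hy⟩ hch.directedOn] at hx
  obtain ⟨z, hz, hxz⟩ := hx
  exact hc hz x hxz

lemma exists_maximal_disjoint (E : Submodule S I) :
    ∃ C : Submodule S I, Maximal (fun C => Disjoint E C) C := by
  refine zorn_le₀ {C | Disjoint E C} (fun c hc hch => ?_)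
  rcases c.eq_empty_or_nonempty with rfl | hne
  · exact ⟨⊥, disjoint_bot_right, fun z hz => hz.elim⟩
  refine ⟨sSup c, ?_, fun z hz => le_sSup hz⟩
  rw [Set.mem_ofPred_eq, Submodule.disjoint_def]
  intro x hxE hx
  rw [Submodule.mem_sSup_of_directed hne hch.directedOn] at hx
  obtain ⟨z, hz, hxz⟩ := hx
  exact Submodule.disjoint_def.mp (hc hz) x hxE hxz

/-- A maximal essential extension inside an injective module is injective. -/
lemma Maximal.injective_of_isEssentialOver [Module.Injective S I] {K E : Submodule S I}
    (hE : Maximal (IsEssentialOver K) E) : Module.Injective S E := by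
  obtain ⟨C, hC⟩ := exists_maximal_disjoint E
  have hinj : Function.Injective (C.mkQ ∘ₗ E.subtype) := by
    rw [injective_iff_map_eq_zero]
    rintro ⟨x, hx⟩ h0
    have : x ∈ C := by simpa using h0
    simpa using Submodule.disjoint_def.mp hC.prop x hx this
  obtain ⟨h, hh⟩ := Module.Injective.out (R := S) (Q := I) (C.mkQ ∘ₗ E.subtype) hinj E.subtype
  have hh' (x : I) (hx : x ∈ E) : h (C.mkQ x) = x := hh ⟨x, hx⟩
  have hess (x : I) (hx : x ∉ C) : ∃ r : S, ∃ e ∈ E, e ≠ 0 ∧ C.mkQ (r • x) = C.mkQ e := by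
    have : ¬ Disjoint E (C ⊔ Submodule.span S {x}) := fun hd =>
      hx ((hC.le_of_ge hd le_sup_left) (Submodule.mem_sup_right
        (Submodule.mem_span_singleton_self x)))
    rw [Submodule.disjoint_def] at this
    push Not at this
    obtain ⟨e, he, heC, he0⟩ := this
    obtain ⟨c, hc, y, hy, rfl⟩ := Submodule.mem_sup.mp heC
    obtain ⟨r, rfl⟩ := Submodule.mem_span_singleton.mp hy
    refine ⟨r, _, he, he0, ?_⟩
    rw [map_add, (C.mkQ_apply c).trans ((Submodule.Quotient.mk_eq_zero C).mpr hc), zero_add]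
  have hrange : LinearMap.range h ≤ E := by
    have hle : E ≤ LinearMap.range h := fun x hx => ⟨C.mkQ x, hh' x hx⟩
    refine hE.le_of_ge ?_ hle
    rintro _ ⟨y, rfl⟩ h0
    obtain ⟨x, rfl⟩ := C.mkQ_surjective y
    have hxC : x ∉ C := fun hx => h0 (by
      rw [(C.mkQ_apply x).trans ((Submodule.Quotient.mk_eq_zero C).mpr hx), map_zero])
    obtain ⟨r, e, he, he0, hr⟩ := hess x hxC
    obtain ⟨t, ht, ht0⟩ := hE.prop e he he0
    refine ⟨t * r, ?_⟩
    have : (t * r) • h (C.mkQ x) = t • e := by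
      rw [mul_smul, ← map_smul h r, ← map_smul C.mkQ, hr, hh' e he]
    rw [this]
    exact ⟨ht, ht0⟩
  refine ⟨fun X Y _ _ _ _ f hf g => ?_⟩
  obtain ⟨G, hG⟩ := Module.Injective.out (R := S) (Q := I) f hf (E.subtype ∘ₗ g)
  refine ⟨(h ∘ₗ C.mkQ).codRestrict E (fun x => hrange ⟨_, rfl⟩) ∘ₗ G, fun x => ?_⟩
  apply Subtype.ext
  have := hG x
  simp only [LinearMap.comp_apply, Submodule.subtype_apply] at this
  simp only [LinearMap.comp_apply, LinearMap.codRestrict_apply, this]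
  exact hh' _ (g x).2

end InjectiveHull

lemma exists_smul_mem_socle {S H : Type*} [CommRing S] [AddCommGroup H] [Module S H] {m : Ideal S}
    {x : H} (hx : x ∈ powTorsion m H) (h0 : x ≠ 0) :
    ∃ r : S, r • x ≠ 0 ∧ ∀ s ∈ m, s • r • x = 0 := by
  classical
  have hx' : ∃ n : ℕ, ∀ r ∈ m ^ n, r • x = 0 := hx
  obtain ⟨n, hn⟩ : ∃ n, Nat.find hx' = n + 1 := by
    refine Nat.exists_eq_succ_of_ne_zero fun h => h0 ?_
    have := Nat.find_spec hx' 1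
    rw [h] at this
    simpa using this
  have hmin := Nat.find_min hx' (m := n) (by omega)
  push Not at hmin
  obtain ⟨r, hr, hr0⟩ := hmin
  refine ⟨r, hr0, fun s hs => ?_⟩
  rw [← mul_smul]
  refine Nat.find_spec hx' _ ?_
  rw [hn, pow_succ']
  exact Ideal.mul_mem_mul hs hr

open IsLocalRing in
/-- An injective module with finite socle cogenerating the torsion modules. -/
lemma exists_injective_cogenerator (S : Type u) [CommRing S] [IsLocalRing S]
    [IsNoetherianRing S] :
    ∃ (E : Type u) (_ : AddCommGroup E) (_ : Module S E), Module.Injective S E ∧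
      IsNoetherian S ((S ⧸ maximalIdeal S) →ₗ[S] E) ∧
      ∀ (H : Type u) [AddCommGroup H] [Module S H], powTorsion (maximalIdeal S) H = ⊤ →
        (∀ f : H →ₗ[S] E, f = 0) → Subsingleton H := by
  obtain ⟨I, _, _, j, _, hj⟩ := exists_injective_module S (S ⧸ maximalIdeal S)
  obtain ⟨E, hKE, hE⟩ := exists_maximal_isEssentialOver (LinearMap.range j)
  have hinj := hE.injective_of_isEssentialOver
  refine ⟨E, inferInstance, inferInstance, hinj, ?_, ?_⟩
  · have hsoc (f : (S ⧸ maximalIdeal S) →ₗ[S] E) : (f 1 : I) ∈ LinearMap.range j := by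
      by_cases h0 : (f 1 : I) = 0
      · rw [h0]; exact zero_mem _
      obtain ⟨r, hr, hr0⟩ := hE.prop _ (f 1).2 h0
      have hu : IsUnit r := by
        by_contra hu
        apply hr0
        have : r • (1 : S ⧸ maximalIdeal S) = 0 := by
          rw [Algebra.smul_def, mul_one]
          exact Ideal.Quotient.eq_zero_iff_mem.mpr hu
        rw [← Submodule.coe_smul, ← map_smul, this, map_zero, Submodule.coe_zero]
      exact (Submodule.smul_mem_iff_of_isUnit _ hu).mp hr
    let ev : ((S ⧸ maximalIdeal S) →ₗ[S] E) →ₗ[S] LinearMap.range j :=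
      LinearMap.codRestrict _ (E.subtype ∘ₗ LinearMap.applyₗ' S (1 : S ⧸ maximalIdeal S)) hsoc
    have : IsNoetherian S (LinearMap.range j) :=
      isNoetherian_of_surjective j.rangeRestrict j.range_rangeRestrict
    refine isNoetherian_of_injective ev fun f g hfg => ?_
    have h1 : f 1 = g 1 := Subtype.ext congr(($hfg : I))
    ext
    simpa using congr(($h1 : I))
  · intro H _ _ hH h
    refine subsingleton_of_forall_eq 0 fun x => ?_
    by_contra h0
    obtain ⟨r, hr0, hr⟩ := exists_smul_mem_socle (m := maximalIdeal S) (x := x)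
      (hH ▸ Submodule.mem_top) h0
    let i : (S ⧸ maximalIdeal S) →ₗ[S] H :=
      Submodule.liftQ (maximalIdeal S) (LinearMap.toSpanSingleton S H (r • x)) hr
    have hi1 : i 1 = r • x := (Submodule.liftQ_apply _ _ _).trans (one_smul _ _)
    have hi : Function.Injective i := by
      rw [injective_iff_map_eq_zero]
      intro y hy
      obtain ⟨y, rfl⟩ := Ideal.Quotient.mk_surjective y
      have hy' : y • r • x = 0 := (Submodule.liftQ_apply _ _ _).symm.trans hy
      rw [Ideal.Quotient.eq_zero_iff_mem]
      by_contra hu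
      have hu : IsUnit y := by simpa using hu
      exact hr0 (hu.smul_eq_zero.mp hy')
    obtain ⟨g, hg⟩ := Module.Injective.out (R := S) (Q := E) i hi
      (j.codRestrict E fun y => hKE ⟨y, rfl⟩)
    have h1 := hg 1
    rw [h g, LinearMap.zero_apply] at h1
    have h2 : j 1 = 0 := congr(($h1 : I)).symm
    exact one_ne_zero (hj (h2.trans (map_zero j).symm))

lemma mem_powTorsion_of_exact {A M N P : Type*} [CommRing A] [IsNoetherianRing A]
    [AddCommGroup M] [Module A M] [AddCommGroup N] [Module A N] [AddCommGroup P] [Module A P]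
    {m : Ideal A} {f : M →ₗ[A] N} {g : N →ₗ[A] P} (hfg : Function.Exact f g)
    (hM : powTorsion m M = ⊤) {x : N} (hx : g x ∈ powTorsion m P) : x ∈ powTorsion m N := by
  obtain ⟨n, hn⟩ := mem_powTorsion.mp hx
  let V : Submodule A N := m ^ n • Submodule.span A {x}
  have hV : powTorsion m V = ⊤ := by
    refine eq_top_iff.mpr fun v _ => ?_
    have hle : V ≤ powTorsion m N := by
      refine Submodule.smul_le.mpr fun r hr y hy => ?_
      obtain ⟨c, rfl⟩ := Submodule.mem_span_singleton.mp hy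
      rw [smul_comm]
      refine Submodule.smul_mem _ _ ?_
      obtain ⟨y, hy⟩ := (hfg (r • x)).mp (by rw [map_smul, hn r hr])
      rw [← hy]
      exact map_mem_powTorsion f (hM ▸ Submodule.mem_top)
    obtain ⟨k, hk⟩ := mem_powTorsion.mp (hle v.2)
    exact mem_powTorsion.mpr ⟨k, fun r hr => Subtype.ext (hk r hr)⟩
  have : Module.Finite A V :=
    Module.Finite.iff_fg.mpr (Submodule.FG.smul (IsNoetherian.noetherian (m ^ n))
      (Submodule.fg_span_singleton x))
  obtain ⟨k, hk⟩ := exists_pow_smul_eq_zero_of_finite hV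
  refine mem_powTorsion.mpr ⟨k + n, fun r hr => ?_⟩
  rw [pow_add] at hr
  refine Submodule.mul_induction_on hr (fun s hs t ht => ?_) fun a b ha hb => ?_
  · rw [mul_smul]
    exact congr_arg Subtype.val (hk s hs ⟨t • x, Submodule.smul_mem_smul ht
      (Submodule.mem_span_singleton_self x)⟩)
  · rw [add_smul, ha, hb, add_zero]

lemma exists_comp_eq_of_injective {S : Type u} [CommRing S] {N P E : Type u} [AddCommGroup N]
    [Module S N] [AddCommGroup P] [Module S P] [AddCommGroup E] [Module S E] [Module.Injective S E]
    (g : N →ₗ[S] P) (φ : N →ₗ[S] E) (h : ∀ x, g x = 0 → φ x = 0) : ∃ ψ : P →ₗ[S] E, ψ ∘ₗ g = φ := by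
  obtain ⟨ψ, hψ⟩ := Module.Injective.out (R := S) (Q := E) ((LinearMap.ker g).liftQ g le_rfl)
    (LinearMap.ker_eq_bot.mp (Submodule.ker_liftQ_eq_bot _ _ _ le_rfl))
    ((LinearMap.ker g).liftQ φ h)
  refine ⟨ψ, LinearMap.ext fun x => ?_⟩
  exact hψ (Submodule.Quotient.mk x)

lemma isNoetherian_hom_of_exact {S : Type u} [CommRing S] {M N P E : Type u} [AddCommGroup M]
    [Module S M] [AddCommGroup N] [Module S N] [AddCommGroup P] [Module S P] [AddCommGroup E]
    [Module S E] [Module.Injective S E] {f : M →ₗ[S] N} {g : N →ₗ[S] P} (hfg : Function.Exact f g)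
    [IsNoetherian S (M →ₗ[S] E)] [IsNoetherian S (P →ₗ[S] E)] : IsNoetherian S (N →ₗ[S] E) := by
  refine isNoetherian_of_range_eq_ker (LinearMap.lcomp S E g) (LinearMap.lcomp S E f) ?_
  refine le_antisymm ?_ fun φ hφ => ?_
  · rintro _ ⟨ψ, rfl⟩
    ext x
    simp [hfg.apply_apply_eq_zero]
  · obtain ⟨ψ, hψ⟩ := exists_comp_eq_of_injective g φ fun x hx => by
      obtain ⟨y, rfl⟩ := (hfg x).mp hx
      exact LinearMap.congr_fun hφ y
    exact ⟨ψ, hψ⟩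

instance isPrecomplete_fin_fun {S : Type*} [CommRing S] (I : Ideal S) [IsPrecomplete I S] (n : ℕ) :
    IsPrecomplete I (Fin n → S) := by
  rw [← AdicCompletion.of_surjective_iff]
  intro x
  choose y hy using fun j => AdicCompletion.of_surjective I S (AdicCompletion.piEquivFin I n x j)
  refine ⟨y, (AdicCompletion.piEquivFin I n).injective (funext fun j => ?_)⟩
  rw [← hy j]
  simp only [AdicCompletion.piEquivFin_apply]
  exact AdicCompletion.map_of I (LinearMap.proj j : (Fin n → S) →ₗ[S] S) y

/-- Nakayama's lemma over a complete ring. -/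
lemma finite_of_isHausdorff {S K : Type*} [CommRing S] (I : Ideal S) [IsPrecomplete I S]
    [AddCommGroup K] [Module S K] [IsHausdorff I K]
    (h : Module.Finite S (K ⧸ (I • ⊤ : Submodule S K))) : Module.Finite S K := by
  obtain ⟨n, f, hf⟩ := Module.Finite.exists_fin' S (K ⧸ (I • ⊤ : Submodule S K))
  obtain ⟨g, hg⟩ := Module.projective_lifting_property (Submodule.mkQ (I • ⊤ : Submodule S K)) f
    (Submodule.mkQ_surjective _)
  exact Module.Finite.of_surjective g (surjective_of_mkQ_comp_surjective (I := I) (hg ▸ hf))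

/-- Torsion modules whose dual into `E` is finitely generated. -/
structure IsCofin {S : Type u} [CommRing S] (m : Ideal S) (E : Type u) [AddCommGroup E] [Module S E]
    (H : Type u) [AddCommGroup H] [Module S H] : Prop where
  powTorsion_eq_top : powTorsion m H = ⊤
  isNoetherian_hom : IsNoetherian S (H →ₗ[S] E)

namespace IsCofin

variable {S : Type u} [CommRing S] [IsNoetherianRing S] {m : Ideal S}
variable {E : Type u} [AddCommGroup E] [Module S E]
variable {M : Type u} [AddCommGroup M] [Module S M]
variable {N : Type u} [AddCommGroup N] [Module S N]
variable {P : Type u} [AddCommGroup P] [Module S P]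

omit [IsNoetherianRing S] in
lemma of_subsingleton (h : Subsingleton M) : IsCofin m E M where
  powTorsion_eq_top := Subsingleton.elim _ _
  isNoetherian_hom := by
    have : Subsingleton (M →ₗ[S] E) := ⟨fun f g => LinearMap.ext fun x => by
      rw [Subsingleton.elim x 0, map_zero, map_zero]⟩
    exact isNoetherian_of_finite S _

variable [Module.Injective S E]

lemma of_exact {f : M →ₗ[S] N} {g : N →ₗ[S] P} (hfg : Function.Exact f g)
    (hM : IsCofin m E M) (hP : IsCofin m E P) : IsCofin m E N where
  powTorsion_eq_top := eq_top_iff.mpr fun _ _ => mem_powTorsion_of_exact hfg hM.1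
    (hP.1 ▸ Submodule.mem_top)
  isNoetherian_hom := by
    have := hM.2
    have := hP.2
    exact isNoetherian_hom_of_exact hfg

lemma of_injective {g : N →ₗ[S] P} (hg : Function.Injective g) (hP : IsCofin m E P) :
    IsCofin m E N :=
  of_exact (f := (0 : PUnit.{u + 1} →ₗ[S] N)) (fun y => by
    rw [← g.map_zero, hg.eq_iff]
    simp [eq_comm]) (of_subsingleton inferInstance) hP

/-- A module is cofinite as soon as the kernel of a locally nilpotent multiplication is. -/
lemma of_exact_lsmul [IsPrecomplete m S] {f : M →ₗ[S] N} {x : S} (hx : x ∈ m)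
    (hf : Function.Exact f (LinearMap.lsmul S N x)) (hM : IsCofin m E M)
    (hN : ∀ z : N, ∃ n : ℕ, x ^ n • z = 0) : IsCofin m E N := by
  have htop : powTorsion m N = ⊤ := by
    refine eq_top_iff.mpr fun z _ => ?_
    obtain ⟨n, hn⟩ := hN z
    induction n generalizing z with
    | zero =>
      rw [pow_zero, one_smul] at hn
      rw [hn]
      exact zero_mem _
    | succ n ih =>
      refine mem_powTorsion_of_exact hf hM.1 (ih (x • z) trivial ?_)
      rwa [← mul_smul, ← pow_succ]
  refine ⟨htop, ?_⟩
  have hhaus : IsHausdorff m (N →ₗ[S] E) := by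
    refine ⟨fun φ hφ => LinearMap.ext fun z => ?_⟩
    obtain ⟨n, hn⟩ := mem_powTorsion.mp (htop ▸ Submodule.mem_top : z ∈ powTorsion m N)
    have h1 := hφ n
    rw [SModEq.zero] at h1
    refine Submodule.smul_induction_on h1 (fun r hr ψ _ => ?_) fun a b ha hb => ?_
    · rw [LinearMap.smul_apply, ← map_smul, hn r hr, map_zero, LinearMap.zero_apply]
    · rw [LinearMap.add_apply, ha, hb, LinearMap.zero_apply, add_zero]
  have : Module.Finite S ((N →ₗ[S] E) ⧸ (m • ⊤ : Submodule S (N →ₗ[S] E))) := by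
    have := hM.2
    let F := LinearMap.lcomp S E f
    have hker : LinearMap.ker F ≤ (m • ⊤ : Submodule S (N →ₗ[S] E)) := by
      intro φ hφ
      obtain ⟨ψ, hψ⟩ := exists_comp_eq_of_injective (LinearMap.lsmul S N x) φ fun z hz => by
        obtain ⟨y, rfl⟩ := (hf z).mp hz
        exact LinearMap.congr_fun hφ y
      have : φ = x • ψ := by
        rw [← hψ]
        ext z
        simp
      rw [this]
      exact Submodule.smul_mem_smul hx trivial
    have : IsNoetherian S ((N →ₗ[S] E) ⧸ LinearMap.ker F) :=
      isNoetherian_of_injective ((LinearMap.ker F).liftQ F le_rfl)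
        (LinearMap.ker_eq_bot.mp (Submodule.ker_liftQ_eq_bot _ _ _ le_rfl))
    exact Module.Finite.of_surjective (Submodule.factor hker) (Submodule.factor_surjective hker)
  have := finite_of_isHausdorff m this
  infer_instance

end IsCofin

section Dimension

variable {A : Type u} [CommRing A]

lemma WithBot.natCast_le_of_add_one_le {x : WithBot ℕ∞} {n : ℕ}
    (h : ((n + 1 : ℕ) : WithBot ℕ∞) ≤ x + 1) : (n : WithBot ℕ∞) ≤ x := by
  induction x with
  | bot => exact absurd h (by simp)
  | coe x =>
    induction x with
    | top => exact le_top (α := WithBot ℕ∞)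
    | coe x =>
      norm_cast at h ⊢
      simpa using h

lemma WithBot.lt_natCast_succ_iff {x : WithBot ℕ∞} {n : ℕ} :
    x < ((n + 1 : ℕ) : WithBot ℕ∞) ↔ x ≤ (n : WithBot ℕ∞) := by
  induction x with
  | bot => simp
  | coe x =>
    induction x with
    | top =>
      constructor
      · intro h
        exact absurd h (not_lt.mpr (le_top (α := WithBot ℕ∞)))
      · intro h
        exact absurd h (by norm_cast)
    | coe x =>
      norm_cast
      exact Nat.lt_succ_iff

lemma exists_isPrime_le_ringKrullDim_quotient {I : Ideal A} {n : ℕ}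
    (h : (n : WithBot ℕ∞) ≤ ringKrullDim (A ⧸ I)) :
    ∃ q : Ideal A, q.IsPrime ∧ I ≤ q ∧ (n : WithBot ℕ∞) ≤ ringKrullDim (A ⧸ q) := by
  rw [ringKrullDim_quotient, Order.le_krullDim_iff] at h
  obtain ⟨l, rfl⟩ := h
  refine ⟨l.head.1.asIdeal, l.head.1.2, l.head.2, ?_⟩
  rw [ringKrullDim_quotient, Order.le_krullDim_iff]
  exact ⟨⟨l.length, fun i => ⟨(l i).1, l.head_le i⟩, l.step⟩, rfl⟩

lemma ringKrullDim_quotient_le_quotient_sup_add_one [IsNoetherianRing A] [IsLocalRing A]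
    (q : Ideal A) (hq : q ≠ ⊤) {x : A} (hx : x ∈ IsLocalRing.maximalIdeal A) :
    ringKrullDim (A ⧸ q) ≤ ringKrullDim (A ⧸ (q ⊔ Ideal.span {x})) + 1 := by
  have : Nontrivial (A ⧸ q) := Ideal.Quotient.nontrivial_iff.mpr hq
  have : IsLocalRing (A ⧸ q) := .of_surjective' _ Ideal.Quotient.mk_surjective
  have hj : Ideal.Quotient.mk q x ∈ Ring.jacobson (A ⧸ q) := by
    rw [IsLocalRing.ringJacobson_eq_maximalIdeal]
    rw [IsLocalRing.mem_maximalIdeal, mem_nonunits_iff]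
    intro hu
    obtain ⟨y, hy⟩ := hu.exists_right_inv
    obtain ⟨y, rfl⟩ := Ideal.Quotient.mk_surjective y
    rw [← map_mul, ← map_one (Ideal.Quotient.mk q), Ideal.Quotient.mk_eq_mk_iff_sub_mem] at hy
    have h1 := Ideal.sub_mem _ (Ideal.mul_mem_right y _ hx) (IsLocalRing.le_maximalIdeal hq hy)
    rw [sub_sub_cancel] at h1
    exact (Ideal.ne_top_iff_one _).mp Ideal.IsPrime.ne_top' h1
  refine (ringKrullDim_le_ringKrullDim_quotient_add_card {Ideal.Quotient.mk q x} (by simpa)).trans ?_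
  rw [Finset.card_singleton, Nat.cast_one]
  gcongr
  rw [Finset.coe_singleton]
  refine ringKrullDim_le_of_surjective (Ideal.Quotient.lift _ ((Ideal.Quotient.mk
    (Ideal.span {Ideal.Quotient.mk q x})).comp (Ideal.Quotient.mk q)) ?_) ?_
  · intro y hy
    change y ∈ RingHom.ker ((Ideal.Quotient.mk
      (Ideal.span {Ideal.Quotient.mk q x})).comp (Ideal.Quotient.mk q))
    revert y
    change q ⊔ Ideal.span {x} ≤ _
    refine sup_le (fun y hy => ?_) ((Ideal.span_singleton_le_iff_mem _).mpr ?_)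
    · simp [RingHom.mem_ker, Ideal.Quotient.eq_zero_iff_mem.mpr hy]
    · simp [RingHom.mem_ker]
  · exact Ideal.Quotient.lift_surjective_of_surjective _ _
      (Ideal.Quotient.mk_surjective.comp Ideal.Quotient.mk_surjective)

lemma exists_isPrime_ringKrullDim_quotient_eq [IsNoetherianRing A] [IsLocalRing A]
    {q : Ideal A} [q.IsPrime] {x : A} (hx : x ∈ IsLocalRing.maximalIdeal A) (hxq : x ∉ q) {n : ℕ}
    (h : ringKrullDim (A ⧸ q) = (n + 1 : ℕ)) :
    ∃ q' : Ideal A, q'.IsPrime ∧ q ⊔ Ideal.span {x} ≤ q' ∧ ringKrullDim (A ⧸ q') = n := by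
  obtain ⟨q', hq', hle, hn⟩ := exists_isPrime_le_ringKrullDim_quotient
    (WithBot.natCast_le_of_add_one_le
      (h ▸ ringKrullDim_quotient_le_quotient_sup_add_one q Ideal.IsPrime.ne_top' hx))
  refine ⟨q', hq', hle, le_antisymm ?_ hn⟩
  have hlt : q < q' := lt_of_le_of_ne (le_sup_left.trans hle) fun he =>
    hxq (he ▸ hle (Ideal.mem_sup_right (Ideal.mem_span_singleton_self x)))
  rw [← WithBot.lt_natCast_succ_iff]
  refine WithBot.lt_of_add_one_le_of_lt_succ (ringKrullDim_quotient_add_one_le hlt) ?_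
  rw [h, WithBot.lt_natCast_succ_iff]

lemma eq_maximalIdeal_of_ringKrullDim_quotient_le_zero [IsLocalRing A] {q : Ideal A} [q.IsPrime]
    (h : ringKrullDim (A ⧸ q) ≤ 0) : q = IsLocalRing.maximalIdeal A := by
  by_contra hne
  have hlt := lt_of_le_of_ne (IsLocalRing.le_maximalIdeal Ideal.IsPrime.ne_top') hne
  have h1 := WithBot.lt_of_add_one_le_of_lt_succ (n := 0) (ringKrullDim_quotient_add_one_le hlt)
    (WithBot.lt_natCast_succ_iff.mpr (by simpa using h))
  have h2 : 0 ≤ ringKrullDim (A ⧸ IsLocalRing.maximalIdeal A) := ringKrullDim_nonneg_of_nontrivial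
  exact absurd (h2.trans_lt h1) (by simp)

lemma ringKrullDim_quotient_lt_of_notMem {q : Ideal A} [q.IsPrime] {x : A} (hx : x ∉ q) {n : ℕ}
    (h : ringKrullDim (A ⧸ q) ≤ n) {q' : Ideal A} (hq' : q ⊔ Ideal.span {x} ≤ q') :
    ringKrullDim (A ⧸ q') < n := by
  have hlt : q < q' := lt_of_le_of_ne (le_sup_left.trans hq') fun he =>
    hx (he ▸ hq' (Ideal.mem_sup_right (Ideal.mem_span_singleton_self x)))
  exact WithBot.lt_of_add_one_le_of_lt_succ (ringKrullDim_quotient_add_one_le hlt)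
    (WithBot.lt_natCast_succ_iff.mpr h)

/-- A finite module whose associated primes all equal `m` is killed by a power of `m`. -/
lemma exists_pow_smul_eq_zero_of_associatedPrimes [IsNoetherianRing A] {m : Ideal A} {K : Type*}
    [AddCommGroup K] [Module A K] [Module.Finite A K]
    (h : ∀ P ∈ associatedPrimes A K, m ≤ P) : ∃ k : ℕ, ∀ r ∈ m ^ k, ∀ x : K, r • x = 0 := by
  have hle : m ≤ (Module.annihilator A K).radical := by
    rw [← Ideal.sInf_minimalPrimes]
    exact le_sInf fun P hP => h P (Module.associatedPrimes.minimalPrimes_annihilator_subset_associatedPrimes A K hP)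
  obtain ⟨k, hk⟩ := Ideal.exists_pow_le_of_le_radical_of_fg hle (IsNoetherian.noetherian m)
  exact ⟨k, fun r hr x => Module.mem_annihilator.mp (hk hr) x⟩

end Dimension

namespace ExtLC

variable {A : Type u} [CommRing A] {a : Ideal A}

lemma map_lsmul (a : Ideal A) (i : ℕ) (M : Type u) [AddCommGroup M] [Module A M] (x : A) :
    map a i (LinearMap.lsmul A M x) = LinearMap.lsmul A (ExtLC a i M) x := by
  ext z
  rw [map_lsmul_apply, LinearMap.lsmul_apply]

variable [IsNoetherianRing A]

/-- Multiplication by `x ∉ q` is surjective in degrees bounded below by the dimension. -/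
lemma smul_surjective_quotient {q : Ideal A} [q.IsPrime] {x : A} (hx : x ∉ q) {i : ℕ}
    (h : ringKrullDim (A ⧸ q) ≤ i) (z : ExtLC a i (A ⧸ q)) : ∃ w, x • w = z := by
  have h0 : Subsingleton (ExtLC a i (A ⧸ (q ⊔ Ideal.span {x}))) :=
    subsingleton_of_ringKrullDim_lt a i (q ⊔ Ideal.span {x})
      (fun q' _ hle => ringKrullDim_quotient_lt_of_notMem hx h hle) _ inferInstance
      (by rw [Ideal.annihilator_quotient])
  obtain ⟨w, hw⟩ := (exact₂ a i (lsmul_quotient_injective hx)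
    (Submodule.factor_surjective (le_sup_left : q ≤ q ⊔ Ideal.span {x}))
    (exact_lsmul_factor q x) z).mp (Subsingleton.elim _ _)
  exact ⟨w, by rw [← hw, map_lsmul_apply]⟩

lemma isCofin [IsLocalRing A] [IsPrecomplete (IsLocalRing.maximalIdeal A) A]
    {E : Type u} [AddCommGroup E] [Module A E] [Module.Injective A E]
    (hE : IsNoetherian A ((A ⧸ IsLocalRing.maximalIdeal A) →ₗ[A] E))
    (ha : a ≤ IsLocalRing.maximalIdeal A) (Φ : ℕ → Ideal A → Prop)
    (h0 : ∀ q : Ideal A, q.IsPrime → Φ 0 q → a ≤ q → q = IsLocalRing.maximalIdeal A)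
    (hs : ∀ i, ∀ q q' : Ideal A, q.IsPrime → q'.IsPrime → Φ (i + 1) q → q < q' → Φ i q') (i : ℕ) :
    ∀ (I : Ideal A) (_ : ∀ q : Ideal A, q.IsPrime → I ≤ q → Φ i q)
      (M : Type u) [AddCommGroup M] [Module A M] (_ : Module.Finite A M)
      (_ : I ≤ Module.annihilator A M), IsCofin (IsLocalRing.maximalIdeal A) E (ExtLC a i M) := by
  induction i with
  | zero =>
    intro I h M _ _ hM hI
    refine induction_of_le_annihilator I
      (fun N _ _ => IsCofin (IsLocalRing.maximalIdeal A) E (ExtLC a 0 N)) ?_ ?_ ?_ ?_ M hM hI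
    · intro N _ _ _
      exact .of_injective evalOne_injective (.of_subsingleton ‹_›)
    · intro N N' _ _ _ _ e h
      exact .of_injective (map_zero_injective (f := e.toLinearMap) e.injective) h
    · intro q hq hIq
      by_cases haq : a ≤ q
      · obtain rfl := h0 q hq (h q hq hIq) haq
        refine .of_injective evalOne_injective ⟨powTorsion_eq_top_of_le_annihilator fun r hr x =>
          Module.mem_annihilator.mp (Ideal.annihilator_quotient.symm.le hr) x, hE⟩
      · obtain ⟨x, hxa, hxq⟩ := SetLike.not_le_iff_exists.mp haq
        refine .of_subsingleton (subsingleton_of_injective_smul hxa fun z hz =>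
          map_zero_injective (lsmul_quotient_injective hxq) ?_)
        rw [map_lsmul_apply, map_zero, hz]
    · intro N₁ N₂ N₃ _ _ _ _ _ _ f g hf hg hfg h₁ h₃
      exact .of_exact (exact₂ a 0 hf hg hfg) h₁ h₃
  | succ i ih =>
    intro I h M _ _ hM hI
    refine induction_of_le_annihilator I
      (fun N _ _ => IsCofin (IsLocalRing.maximalIdeal A) E (ExtLC a (i + 1) N)) ?_ ?_ ?_ ?_ M hM hI
    · intro N _ _ _
      refine .of_subsingleton (subsingleton_of_powTorsion_eq_top i N (eq_top_iff.mpr fun x _ => ?_))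
      rw [Subsingleton.elim x 0]
      exact zero_mem _
    · intro N N' _ _ _ _ e h
      refine .of_injective (g := map a (i + 1) e.toLinearMap) (fun x y hxy => ?_) h
      have := congr_arg (map a (i + 1) e.symm.toLinearMap) hxy
      rwa [map_comp_apply, map_comp_apply, e.symm_comp, map_id_apply, map_id_apply] at this
    · intro q hq hIq
      by_cases haq : a ≤ q
      · exact .of_subsingleton (subsingleton_of_powTorsion_eq_top i _
          (powTorsion_eq_top_of_le_annihilator fun r hr x =>
            Module.mem_annihilator.mp ((haq.trans_eq Ideal.annihilator_quotient.symm) hr) x))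
      · obtain ⟨x, hxa, hxq⟩ := SetLike.not_le_iff_exists.mp haq
        have hex := exact₁ a i (lsmul_quotient_injective hxq)
          (Submodule.factor_surjective (le_sup_left : q ≤ q ⊔ Ideal.span {x}))
          (exact_lsmul_factor q x)
        rw [map_lsmul] at hex
        refine .of_exact_lsmul (ha hxa) hex
          (ih (q ⊔ Ideal.span {x}) (fun q' hq' hle => ?_) _ inferInstance
            (by rw [Ideal.annihilator_quotient])) (exists_pow_smul_eq_zero hxa)
        refine hs i q q' hq hq' (h q hq hIq) (lt_of_le_of_ne (le_sup_left.trans hle) fun he =>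
          hxq (he ▸ hle (Ideal.mem_sup_right (Ideal.mem_span_singleton_self x))))
    · intro N₁ N₂ N₃ _ _ _ _ _ _ f g hf hg hfg h₁ h₃
      exact .of_exact (exact₂ a (i + 1) hf hg hfg) h₁ h₃

end ExtLC

namespace ExtLC

variable {A : Type u} [CommRing A] [IsNoetherianRing A] [IsLocalRing A] {a : Ideal A}

omit [IsLocalRing A] in
/-- A finite module over `A ⧸ I` is killed in cohomological degree `i` by some `s ∉ P`, provided
cohomology vanishes for all primes between `I` and `P`. -/
lemma exists_notMem_smul_eq_zero {P : Ideal A} [P.IsPrime] {i : ℕ} (I : Ideal A)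
    (h : ∀ q : Ideal A, q.IsPrime → I ≤ q → q ≤ P → Subsingleton (ExtLC a i (A ⧸ q)))
    (M : Type u) [AddCommGroup M] [Module A M] (hM : Module.Finite A M)
    (hI : I ≤ Module.annihilator A M) : ∃ s ∉ P, ∀ z : ExtLC a i M, s • z = 0 := by
  have h1 : (1 : A) ∉ P := (Ideal.ne_top_iff_one _).mp Ideal.IsPrime.ne_top'
  refine induction_of_le_annihilator I
    (fun N _ _ => ∃ s ∉ P, ∀ z : ExtLC a i N, s • z = 0) ?_ ?_ ?_ ?_ M hM hI
  · intro N _ _ _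
    refine ⟨1, h1, fun z => ?_⟩
    rw [← map_lsmul_apply, Subsingleton.elim (LinearMap.lsmul A N 1) 0, map_zero_apply]
  · rintro N N' _ _ _ _ e ⟨s, hs, h⟩
    refine ⟨s, hs, fun z => ?_⟩
    have h2 : map a i e.symm.toLinearMap (map a i e.toLinearMap z) = z := by
      rw [map_comp_apply, e.symm_comp, map_id_apply]
    rw [← h2, ← map_smul, h, map_zero]
  · intro q hq hIq
    by_cases hqP : q ≤ P
    · have := h q hq hIq hqP
      exact ⟨1, h1, fun z => Subsingleton.elim _ _⟩
    · obtain ⟨s, hsq, hsP⟩ := SetLike.not_le_iff_exists.mp hqP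
      refine ⟨s, hsP, fun z => ?_⟩
      rw [← map_lsmul_apply]
      have : LinearMap.lsmul A (A ⧸ q) s = 0 := LinearMap.ext fun y =>
        Module.mem_annihilator.mp (Ideal.annihilator_quotient.symm.le hsq) y
      rw [this, map_zero_apply]
  · rintro N₁ N₂ N₃ _ _ _ _ _ _ f g hf hg hfg ⟨s, hs, h₁⟩ ⟨t, ht, h₃⟩
    refine ⟨s * t, fun hst => (Ideal.IsPrime.mem_or_mem ‹_› hst).elim hs ht, fun z => ?_⟩
    obtain ⟨w, hw⟩ := (exact₂ a i hf hg hfg (t • z)).mp (by rw [map_smul, h₃])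
    rw [mul_smul, ← hw, ← map_smul, h₁, map_zero]

variable [IsPrecomplete (IsLocalRing.maximalIdeal A) A]

/-- The Hartshorne–Lichtenbaum vanishing theorem over a complete local ring. -/
theorem subsingleton_of_le_ne_maximalIdeal {P : Ideal A} [hP : P.IsPrime]
    (hPm : P ≠ IsLocalRing.maximalIdeal A) (haP : a ≤ P) (n : ℕ) :
    ∀ (q : Ideal A) (_ : q.IsPrime) (_ : q ≤ P) (_ : ringKrullDim (A ⧸ q) ≤ n),
      Subsingleton (ExtLC a n (A ⧸ q)) := by
  have ha : a ≤ IsLocalRing.maximalIdeal A :=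
    haP.trans (IsLocalRing.le_maximalIdeal Ideal.IsPrime.ne_top')
  induction n with
  | zero =>
    intro q hq hqP hdim
    have := eq_maximalIdeal_of_ringKrullDim_quotient_le_zero (by simpa using hdim)
    exact absurd (le_antisymm (IsLocalRing.le_maximalIdeal Ideal.IsPrime.ne_top') (this ▸ hqP)) hPm
  | succ n ih =>
    intro q hq hqP hdim
    by_cases haq : a ≤ q
    · exact subsingleton_of_powTorsion_eq_top n _ (powTorsion_eq_top_of_le_annihilator fun r hr x =>
        Module.mem_annihilator.mp (Ideal.annihilator_quotient.symm.le (haq hr)) x)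
    obtain ⟨x, hxa, hxq⟩ := SetLike.not_le_iff_exists.mp haq
    obtain ⟨E, _, _, hE, hEn, hcog⟩ := exists_injective_cogenerator A
    have hcof : IsCofin (IsLocalRing.maximalIdeal A) E (ExtLC a (n + 1) (A ⧸ q)) := by
      refine isCofin hEn ha (fun i q => ringKrullDim (A ⧸ q) ≤ i) (fun q hq h _ =>
        eq_maximalIdeal_of_ringKrullDim_quotient_le_zero (by simpa using h))
        (fun i q q' hq _ h hlt => ?_) (n + 1) q (fun q' hq' hle => ?_) _ inferInstance
        (by rw [Ideal.annihilator_quotient])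
      · exact WithBot.lt_natCast_succ_iff.mp (WithBot.lt_of_add_one_le_of_lt_succ
          (ringKrullDim_quotient_add_one_le hlt) (WithBot.lt_natCast_succ_iff.mpr h))
      · exact (ringKrullDim_le_of_surjective (Ideal.Quotient.factor hle)
          (Ideal.Quotient.factor_surjective hle)).trans hdim
    obtain ⟨s, hsP, hs⟩ := exists_notMem_smul_eq_zero (a := a) (P := P) (i := n)
      (q ⊔ Ideal.span {x}) (fun q' hq' hle hq'P => ih q' hq' hq'P
        (WithBot.lt_natCast_succ_iff.mp (ringKrullDim_quotient_lt_of_notMem hxq hdim hle)))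
      (A ⧸ (q ⊔ Ideal.span {x})) inferInstance (by rw [Ideal.annihilator_quotient])
    refine hcog _ hcof.powTorsion_eq_top fun φ => ?_
    have := hcof.isNoetherian_hom
    have hrange : LinearMap.range (algebraMap A (Module.End A (ExtLC a (n + 1) (A ⧸ q) →ₗ[A] E)) s)
        ≤ Ideal.span {x} • ⊤ := by
      rintro _ ⟨ψ, rfl⟩
      have hex := exact₁ a n (lsmul_quotient_injective hxq)
        (Submodule.factor_surjective (le_sup_left : q ≤ q ⊔ Ideal.span {x}))
        (exact_lsmul_factor q x)
      rw [map_lsmul] at hex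
      obtain ⟨χ, hχ⟩ := exists_comp_eq_of_injective
        (LinearMap.lsmul A (ExtLC a (n + 1) (A ⧸ q)) x) (s • ψ) fun z hz => by
          obtain ⟨w, rfl⟩ := (hex z).mp hz
          rw [LinearMap.smul_apply, ← map_smul, ← map_smul, hs, map_zero, map_zero]
      rw [Module.algebraMap_end_apply, ← hχ]
      have : χ ∘ₗ LinearMap.lsmul A (ExtLC a (n + 1) (A ⧸ q)) x = x • χ := by
        ext z
        simp
      rw [this]
      exact Submodule.smul_mem_smul (Ideal.mem_span_singleton_self x) trivial
    obtain ⟨p, hmonic, -, hcoeff, hp⟩ :=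
      LinearMap.exists_monic_and_natDegree_eq_and_coeff_mem_pow_and_aeval_eq_zero A _ _ hrange
    rw [Polynomial.aeval_algebraMap_apply (A := A)
      (B := Module.End A (ExtLC a (n + 1) (A ⧸ q) →ₗ[A] E))] at hp
    have ht : Polynomial.aeval s p ∉ P := by
      intro hmem
      rw [Polynomial.aeval_eq_sum_range, Finset.sum_range_succ, hmonic.coeff_natDegree,
        one_smul] at hmem
      refine hsP (hP.mem_of_pow_mem p.natDegree ((Ideal.add_mem_iff_right _ ?_).mp hmem))
      refine Ideal.sum_mem _ fun k hk => Ideal.mul_mem_right _ _ ?_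
      have hk' : p.natDegree - k ≠ 0 := by
        have := Finset.mem_range.mp hk
        omega
      exact (Ideal.span_singleton_le_iff_mem P).mpr (haP hxa) (Ideal.pow_le_self hk' (hcoeff k))
    ext z
    obtain ⟨w, rfl⟩ := smul_surjective_quotient (a := a) (fun h => ht (hqP h)) hdim z
    rw [map_smul]
    exact LinearMap.congr_fun (LinearMap.congr_fun hp φ) w

/-- Non-vanishing of top local cohomology with support at the closed point. -/
theorem not_subsingleton_of_ringKrullDim_eq (ha : a ≤ IsLocalRing.maximalIdeal A) (n : ℕ) :
    ∀ (q : Ideal A) (_ : q.IsPrime) (_ : ringKrullDim (A ⧸ q) = n)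
      (_ : ∀ q' : Ideal A, q'.IsPrime → q ≤ q' → a ≤ q' → q' = IsLocalRing.maximalIdeal A),
      ¬ Subsingleton (ExtLC a n (A ⧸ q)) := by
  induction n with
  | zero =>
    intro q hq hdim _ hsub
    obtain rfl := eq_maximalIdeal_of_ringKrullDim_quotient_le_zero (by simpa using hdim.le)
    rw [subsingleton_zero_iff, powTorsion_eq_top_of_le_annihilator fun r hr x =>
      Module.mem_annihilator.mp (Ideal.annihilator_quotient.symm.le (ha hr)) x] at hsub
    exact top_ne_bot hsub
  | succ n ih =>
    intro q hq hdim hq' hsub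
    obtain ⟨E, _, _, hE, hEn, hcog⟩ := exists_injective_cogenerator A
    have hcof : IsCofin (IsLocalRing.maximalIdeal A) E (ExtLC a n (A ⧸ q)) :=
      isCofin hEn ha (fun _ q => ∀ q' : Ideal A, q'.IsPrime → q ≤ q' → a ≤ q' →
        q' = IsLocalRing.maximalIdeal A) (fun q hq h haq => h q hq le_rfl haq)
        (fun i q q' _ _ h hlt q'' hq'' hle => h q'' hq'' (hlt.le.trans hle)) n q
        (fun q₁ _ hle q₂ hq₂ hle' => hq' q₂ hq₂ (hle.trans hle')) _ inferInstance
        (by rw [Ideal.annihilator_quotient])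
    have := hcof.isNoetherian_hom
    have haq : ¬ a ≤ q := by
      intro haq
      obtain rfl := hq' q hq le_rfl haq
      have : ringKrullDim (A ⧸ IsLocalRing.maximalIdeal A) = 0 :=
        ringKrullDim_eq_zero_of_field (IsLocalRing.ResidueField A)
      rw [this] at hdim
      exact absurd hdim (by norm_cast)
    obtain ⟨x, hxa, hxq, hxP⟩ : ∃ x ∈ a, x ∉ q ∧ ∀ P ∈ associatedPrimes A
        (ExtLC a n (A ⧸ q) →ₗ[A] E), P ≠ IsLocalRing.maximalIdeal A → x ∉ P := by
      by_contra! hcon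
      have hfin : (insert q {P ∈ associatedPrimes A (ExtLC a n (A ⧸ q) →ₗ[A] E) |
          P ≠ IsLocalRing.maximalIdeal A}).Finite :=
        ((associatedPrimes.finite A _).subset (Set.sep_subset _ _)).insert q
      obtain ⟨P, hPmem, haP⟩ := (Ideal.subset_union_prime_finite (f := id) (I := a) hfin q q
        (fun P hP h _ => ((Set.mem_insert_iff.mp hP).resolve_left h).1.1)).mp (fun x hx => by
          by_cases hxq : x ∈ q
          · exact Set.mem_biUnion (Set.mem_insert _ _) hxq
          · obtain ⟨P, hP, hPm, hxP⟩ := hcon x hx hxq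
            exact Set.mem_biUnion (Set.mem_insert_of_mem _ ⟨hP, hPm⟩) hxP)
      rcases hPmem with rfl | ⟨hP, hPm⟩
      · exact haq haP
      · refine hPm (hq' P hP.1 (fun r hr => ?_) haP)
        have hPprime := hP.1
        obtain ⟨y, rfl⟩ := hP.2
        refine Ideal.le_radical ?_
        rw [Submodule.mem_colon_singleton, Submodule.mem_bot]
        ext z
        rw [LinearMap.smul_apply, ← map_smul, ← map_lsmul_apply]
        have : LinearMap.lsmul A (A ⧸ q) r = 0 := LinearMap.ext fun y =>
          Module.mem_annihilator.mp (Ideal.annihilator_quotient.symm.le hr) y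
        rw [this, map_zero_apply, map_zero, LinearMap.zero_apply]
    have hxm := ha hxa
    obtain ⟨k, hk⟩ : ∃ k : ℕ, ∀ r ∈ IsLocalRing.maximalIdeal A ^ k,
        ∀ y : ExtLC a n (A ⧸ q), ∃ z, x • z = r • y := by
      let K : Submodule A (ExtLC a n (A ⧸ q) →ₗ[A] E) :=
        LinearMap.ker (LinearMap.lsmul A (ExtLC a n (A ⧸ q) →ₗ[A] E) x)
      obtain ⟨k, hk⟩ := exists_pow_smul_eq_zero_of_associatedPrimes (A := A)
        (m := IsLocalRing.maximalIdeal A) (K := K) fun P hP => by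
          by_contra hne
          refine hxP P (associatedPrimes.subset_of_injective K.injective_subtype hP)
            (fun h => hne h.ge) ?_
          have hPprime := hP.1
          obtain ⟨y, rfl⟩ := hP.2
          refine Ideal.le_radical ?_
          rw [Submodule.mem_colon_singleton, Submodule.mem_bot]
          exact Subtype.ext y.2
      refine ⟨k, fun r hr y => ?_⟩
      let Q := ExtLC a n (A ⧸ q) ⧸ LinearMap.range (LinearMap.lsmul A (ExtLC a n (A ⧸ q)) x)
      let π : ExtLC a n (A ⧸ q) →ₗ[A] Q := Submodule.mkQ _
      let T := LinearMap.range (LinearMap.lsmul A Q r)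
      have hT : Subsingleton T := by
        refine hcog T (eq_top_iff.mpr fun t _ => ?_) fun f => ?_
        · obtain ⟨_, ⟨t, rfl⟩⟩ := t
          obtain ⟨t, rfl⟩ := Submodule.mkQ_surjective _ t
          exact map_mem_powTorsion ((LinearMap.lsmul A Q r).rangeRestrict ∘ₗ π)
            (hcof.powTorsion_eq_top ▸ Submodule.mem_top : t ∈ powTorsion _ _)
        · obtain ⟨g, hg⟩ := exists_comp_eq_of_injective T.subtype f fun t ht => by
            rw [(Submodule.coe_eq_zero).mp ht, map_zero]
          have hgK : g ∘ₗ π ∈ K := by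
            refine LinearMap.ext fun z => ?_
            have hz : π (x • z) = 0 := (Submodule.Quotient.mk_eq_zero _).mpr ⟨z, rfl⟩
            change x • g (π z) = 0
            rw [← map_smul, ← map_smul, hz, map_zero]
          have h0 := congr_arg Subtype.val (hk r hr ⟨_, hgK⟩)
          ext ⟨_, ⟨t, rfl⟩⟩
          obtain ⟨t, rfl⟩ := Submodule.mkQ_surjective _ t
          rw [← hg]
          have := LinearMap.congr_fun h0 t
          change r • g (π t) = 0 at this
          change g (r • π t) = 0
          rw [map_smul, this]
      have hy : π (r • y) = 0 := by
        rw [map_smul]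
        exact congr_arg Subtype.val (Subsingleton.elim (⟨r • π y, ⟨π y, rfl⟩⟩ : T) 0)
      exact (Submodule.Quotient.mk_eq_zero _).mp hy
    obtain ⟨q₁, hq₁, hle, hdim₁⟩ := exists_isPrime_ringKrullDim_quotient_eq hxm hxq hdim
    let g := Submodule.factor (le_sup_left : q ≤ q ⊔ Ideal.span {x})
    have hgs : Function.Surjective (map a n g) := by
      have := exact₃ a n (lsmul_quotient_injective hxq)
        (Submodule.factor_surjective (le_sup_left : q ≤ q ⊔ Ideal.span {x}))
        (exact_lsmul_factor q x)
      exact fun z => (this z).mp (Subsingleton.elim _ _)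
    let h := Submodule.factor hle
    have hhs : Function.Surjective (map a n h) := by
      refine map_surjective (f := (LinearMap.ker h).subtype) (Submodule.injective_subtype _)
        (Submodule.factor_surjective hle) (LinearMap.exact_subtype_ker_map h) ?_
      refine subsingleton_of_ringKrullDim_lt a (n + 1) (q ⊔ Ideal.span {x})
        (fun q' _ hle' => ringKrullDim_quotient_lt_of_notMem hxq hdim.le hle') _ inferInstance ?_
      refine (Ideal.annihilator_quotient (I := q ⊔ Ideal.span {x})).symm.le.trans
        (LinearMap.annihilator_le_of_injective _ (Submodule.injective_subtype (LinearMap.ker h)))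
    have hkill : ∀ r ∈ IsLocalRing.maximalIdeal A ^ k, ∀ z : ExtLC a n (A ⧸ q₁), r • z = 0 := by
      intro r hr z
      obtain ⟨z, rfl⟩ := hhs z
      obtain ⟨z, rfl⟩ := hgs z
      obtain ⟨w, hw⟩ := hk r hr z
      have hzero : g ∘ₗ LinearMap.lsmul A (A ⧸ q) x = 0 :=
        LinearMap.ext fun y => (exact_lsmul_factor q x).apply_apply_eq_zero y
      have h0 : map a n g (map a n (LinearMap.lsmul A (A ⧸ q) x) w) = 0 := by
        rw [map_comp_apply, hzero, map_zero_apply]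
      rw [← map_smul, ← map_smul, ← hw, ← map_lsmul_apply, h0, map_zero]
    refine ih q₁ hq₁ hdim₁ (fun q' h₁ h₂ h₃ => hq' q' h₁ ((le_sup_left.trans hle).trans h₂) h₃) ?_
    by_cases hq₁m : q₁ = IsLocalRing.maximalIdeal A
    · have hn : n = 0 := by
        have : ringKrullDim (A ⧸ IsLocalRing.maximalIdeal A) = 0 :=
          ringKrullDim_eq_zero_of_field (IsLocalRing.ResidueField A)
        rw [hq₁m, this] at hdim₁
        exact_mod_cast hdim₁.symm
      subst hn
      have : Subsingleton (ExtLC a 0 (A ⧸ q)) := subsingleton_of_injective_smul hxa fun z hz =>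
        map_zero_injective (lsmul_quotient_injective hxq) (by rw [map_lsmul_apply, map_zero, hz])
      exact (hhs.comp hgs).subsingleton
    · obtain ⟨r, hrm, hrq⟩ := SetLike.exists_of_lt
        (lt_of_le_of_ne (IsLocalRing.le_maximalIdeal hq₁.ne_top) hq₁m)
      have hs (j : ℕ) (z : ExtLC a n (A ⧸ q₁)) : ∃ w, r ^ j • w = z := by
        exact smul_surjective_quotient (fun h => hrq (hq₁.mem_of_pow_mem j h)) hdim₁.le z
      refine subsingleton_of_forall_eq 0 fun z => ?_
      obtain ⟨w, rfl⟩ := hs k z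
      exact hkill _ (Ideal.pow_mem_pow hrm k) w

end ExtLC

/-- A ring map into a complete ring extends to the adic completion of its source. -/
lemma exists_ringHom_adicCompletion {P S : Type*} [CommRing P] [CommRing S] (K : Ideal P)
    (φ : P →+* S) [IsAdicComplete (K.map φ) S] :
    ∃ F : AdicCompletion K P →+* S, ∀ x, F (algebraMap P _ x) = φ x := by
  have hle (k : ℕ) : K ^ k ≤ ((K.map φ) ^ k).comap φ := by
    rw [← Ideal.map_le_iff_le_comap, Ideal.map_pow]
  refine ⟨IsAdicComplete.liftRingHom (K.map φ)
    (fun k => (Ideal.quotientMap _ φ (hle k)).comp (AdicCompletion.evalₐ K k).toRingHom) ?_, ?_⟩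
  · intro m n hmn
    ext x
    obtain ⟨y, rfl⟩ := AdicCompletion.mk_surjective K P x
    have hy : φ (y.val n) - φ (y.val m) ∈ (K.map φ) ^ m := by
      rw [← map_sub]
      refine hle m ?_
      have := y.property hmn
      rw [SModEq.sub_mem, smul_eq_mul, Ideal.mul_top] at this
      rw [← neg_mem_iff, neg_sub]
      exact this
    simpa using Ideal.Quotient.eq.mpr hy
  · intro x
    refine IsHausdorff.eq_iff_smodEq (I := K.map φ) |>.mpr fun n => ?_
    rw [SModEq.sub_mem, smul_eq_mul, Ideal.mul_top, ← Ideal.Quotient.eq,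
      IsAdicComplete.mk_liftRingHom]
    simp

lemma AdicCompletion.isNoetherianRing_mvPolynomial (σ R : Type*) [Finite σ] [CommRing R]
    [IsNoetherianRing R] :
    IsNoetherianRing (AdicCompletion (MvPolynomial.idealOfVars σ R) (MvPolynomial σ R)) :=
  isNoetherianRing_of_ringEquiv _ (MvPowerSeries.toAdicCompletionAlgEquiv σ R).toRingEquiv

/-- The adic completion of a Noetherian ring is Noetherian. -/
theorem AdicCompletion.isNoetherianRing {R : Type*} [CommRing R] [IsNoetherianRing R]
    (I : Ideal R) : IsNoetherianRing (AdicCompletion I R) := by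
  obtain ⟨n, s, hs⟩ := Submodule.fg_iff_exists_fin_generating_family.mp (IsNoetherian.noetherian I)
  let S := AdicCompletion I R
  let K := MvPolynomial.idealOfVars (Fin n) R
  let φ : MvPolynomial (Fin n) R →+* S :=
    (MvPolynomial.aeval (fun i => algebraMap R S (s i))).toRingHom
  have hK : K.map φ = I.map (algebraMap R S) := by
    have hI : I.map (algebraMap R S) = Ideal.span (Set.range (algebraMap R S ∘ s)) := by
      rw [Set.range_comp, ← Ideal.map_span]
      exact congr_arg (Ideal.map (algebraMap R S)) hs.symm
    rw [hI, Ideal.map_span, ← Set.range_comp]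
    congr 2
    ext i
    simp [φ]
  have hcomp : IsAdicComplete (I.map (algebraMap R S)) S :=
    AdicCompletion.isAdicComplete_self I (IsNoetherian.noetherian I)
  have : IsAdicComplete (K.map φ) S := hK ▸ hcomp
  obtain ⟨F, hF⟩ := exists_ringHom_adicCompletion K φ
  have hKfg : K.FG := MvPolynomial.idealOfVars_fg _ _
  have := AdicCompletion.isAdicComplete_self K hKfg
  have hmap : (K.map (algebraMap _ (AdicCompletion K (MvPolynomial (Fin n) R)))).map F =
      I.map (algebraMap R S) := by
    rw [Ideal.map_map, ← hK, RingHom.ext hF (f := F.comp (algebraMap _ _)) (g := φ)]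
  have : IsHausdorff ((K.map (algebraMap _ (AdicCompletion K (MvPolynomial (Fin n) R)))).map F) S :=
    hmap ▸ hcomp.toIsHausdorff
  have hsurj : Function.Surjective F := by
    refine surjective_of_mk_map_comp_surjective
      (I := K.map (algebraMap _ (AdicCompletion K (MvPolynomial (Fin n) R)))) F fun y => ?_
    obtain ⟨y, rfl⟩ := Ideal.Quotient.mk_surjective y
    obtain ⟨r, hr⟩ := Ideal.Quotient.mk_surjective (AdicCompletion.evalOneₐ I y)
    refine ⟨algebraMap (MvPolynomial (Fin n) R) _ (MvPolynomial.C r), ?_⟩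
    rw [RingHom.comp_apply, hF, Ideal.Quotient.eq, hmap,
      ← AdicCompletion.ker_evalOneₐ_eq_map I (IsNoetherian.noetherian I), RingHom.mem_ker]
    simp [φ, ← hr]
  have := AdicCompletion.isNoetherianRing_mvPolynomial (Fin n) R
  exact isNoetherianRing_of_surjective _ _ F hsurj

lemma ringKrullDim_le_of_map_maximalIdeal {R S : Type*} [CommRing R] [CommRing S]
    [IsNoetherianRing R] [IsNoetherianRing S] [IsLocalRing R] [IsLocalRing S] (f : R →+* S)
    (hf : (IsLocalRing.maximalIdeal R).map f = IsLocalRing.maximalIdeal S) :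
    ringKrullDim S ≤ ringKrullDim R := by
  let _ := f.toAlgebra
  have hlies : (IsLocalRing.maximalIdeal S).LiesOver (IsLocalRing.maximalIdeal R) := by
    refine ⟨((IsLocalRing.maximalIdeal.isMaximal R).eq_of_le
      (Ideal.comap_ne_top _ Ideal.IsPrime.ne_top') ?_)⟩
    rw [← Ideal.map_le_iff_le_comap]
    exact hf.le
  have hle := Ideal.height_le_height_add_of_liesOver (IsLocalRing.maximalIdeal R)
    (IsLocalRing.maximalIdeal S)
  have hmap : (IsLocalRing.maximalIdeal R).map (algebraMap R S) = IsLocalRing.maximalIdeal S := hf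
  rw [hmap, Ideal.map_quotient_self] at hle
  have : IsDomain (S ⧸ IsLocalRing.maximalIdeal S) := Ideal.Quotient.isDomain _
  rw [Ideal.height_bot, add_zero] at hle
  rw [← IsLocalRing.maximalIdeal_height_eq_ringKrullDim,
    ← IsLocalRing.maximalIdeal_height_eq_ringKrullDim]
  exact_mod_cast hle

lemma ringKrullDim_quotient_le_quotient_comap {R S : Type*} [CommRing R] [CommRing S]
    [IsNoetherianRing R] [IsNoetherianRing S] [IsLocalRing R] [IsLocalRing S] (f : R →+* S)
    (hf : (IsLocalRing.maximalIdeal R).map f = IsLocalRing.maximalIdeal S) (q : Ideal S)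
    [q.IsPrime] : ringKrullDim (S ⧸ q) ≤ ringKrullDim (R ⧸ q.comap f) := by
  have h1 : IsLocalRing (S ⧸ q) := .of_surjective' _ Ideal.Quotient.mk_surjective
  have h2 : IsLocalRing (R ⧸ q.comap f) := .of_surjective' _ Ideal.Quotient.mk_surjective
  refine ringKrullDim_le_of_map_maximalIdeal (Ideal.quotientMap q f le_rfl) ?_
  rw [← IsLocalRing.map_maximalIdeal_of_surjective (Ideal.Quotient.mk (q.comap f))
    Ideal.Quotient.mk_surjective, Ideal.map_map, Ideal.quotientMap_comp_mk, ← Ideal.map_map, hf,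
    IsLocalRing.map_maximalIdeal_of_surjective _ Ideal.Quotient.mk_surjective]

lemma ringKrullDim_quotient_le_of_le {A : Type*} [CommRing A] {I J : Ideal A} (h : I ≤ J) :
    ringKrullDim (A ⧸ J) ≤ ringKrullDim (A ⧸ I) :=
  ringKrullDim_le_of_surjective (Ideal.Quotient.factor h) (Ideal.Quotient.factor_surjective h)

namespace ExtLC

lemma subsingleton_of_eq_top {A : Type u} [CommRing A] {a : Ideal A} (ha : a = ⊤) (i : ℕ)
    (M : Type u) [AddCommGroup M] [Module A M] : Subsingleton (ExtLC a i M) :=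
  subsingleton_of_injective_smul (r := 1) (ha ▸ trivial) fun z hz => by rwa [one_smul] at hz

section Top

variable {A : Type u} [CommRing A] [IsNoetherianRing A] {a I : Ideal A} {d : ℕ}

lemma subsingleton_of_surjective (hI : ringKrullDim (A ⧸ I) ≤ d) {M N : Type u} [AddCommGroup M]
    [Module A M] [AddCommGroup N] [Module A N] [Module.Finite A M] (hM : I ≤ Module.annihilator A M)
    {g : M →ₗ[A] N} (hg : Function.Surjective g) (h : Subsingleton (ExtLC a d M)) :
    Subsingleton (ExtLC a d N) := by
  refine subsingleton_right (f := (LinearMap.ker g).subtype) (Submodule.injective_subtype _) hg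
    (LinearMap.exact_subtype_ker_map g) h ?_
  refine subsingleton_of_ringKrullDim_lt a (d + 1) I (fun q _ hq => ?_) _ inferInstance
    (hM.trans (LinearMap.annihilator_le_of_injective _ (Submodule.injective_subtype _)))
  exact WithBot.lt_natCast_succ_iff.mpr ((ringKrullDim_quotient_le_of_le hq).trans hI)

/-- If top local cohomology of `A ⧸ I` vanishes, so does that of every module over `A ⧸ I`. -/
lemma subsingleton_of_le_annihilator (hI : ringKrullDim (A ⧸ I) ≤ d)
    (h : Subsingleton (ExtLC a d (A ⧸ I))) (M : Type u) [AddCommGroup M] [Module A M]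
    (hM : I ≤ Module.annihilator A M) : Subsingleton (ExtLC a d M) := by
  have hsub (N : Submodule A M) : I ≤ Module.annihilator A N :=
    hM.trans (LinearMap.annihilator_le_of_injective _ N.injective_subtype)
  have hfg (N : Submodule A M) (hN : N.FG) : Subsingleton (ExtLC a d N) := by
    induction N, hN using Submodule.fg_induction with
    | singleton x =>
      have hker : I ≤ LinearMap.ker ((LinearMap.toSpanSingleton A M x).codRestrict (A ∙ x)
          fun r => Submodule.smul_mem _ r (Submodule.mem_span_singleton_self x)) := fun r hr =>
        Subtype.ext (Module.mem_annihilator.mp (hM hr) x)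
      refine subsingleton_of_surjective hI Ideal.annihilator_quotient.symm.le
        (g := Submodule.liftQ I _ hker) ?_ h
      rintro ⟨y, hy⟩
      obtain ⟨r, rfl⟩ := Submodule.mem_span_singleton.mp hy
      exact ⟨Submodule.Quotient.mk r, rfl⟩
    | sup N₁ N₂ hN₁ hN₂ h₁ h₂ =>
      have : Module.Finite A N₁ := Module.Finite.iff_fg.mpr hN₁
      have : Module.Finite A N₂ := Module.Finite.iff_fg.mpr hN₂
      have hprod : Subsingleton (ExtLC a d (N₁ × N₂)) :=
        subsingleton_mid LinearMap.inl_injective LinearMap.snd_surjective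
          Function.Exact.inl_snd h₁ h₂
      have hann : I ≤ Module.annihilator A (N₁ × N₂) := fun r hr =>
        Module.mem_annihilator.mpr fun x => Prod.ext
          (Module.mem_annihilator.mp (hsub N₁ hr) x.1) (Module.mem_annihilator.mp (hsub N₂ hr) x.2)
      refine subsingleton_of_surjective hI hann (g := LinearMap.coprod
        (Submodule.inclusion le_sup_left) (Submodule.inclusion le_sup_right)) ?_ hprod
      rintro ⟨y, hy⟩
      obtain ⟨y₁, h₁, y₂, h₂, rfl⟩ := Submodule.mem_sup.mp hy
      exact ⟨(⟨y₁, h₁⟩, ⟨y₂, h₂⟩), Subtype.ext (by simp)⟩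
  refine subsingleton_of_forall_eq 0 fun z => ?_
  obtain ⟨N, hN, w, rfl⟩ := exists_fg_map_subtype_eq z
  have := hfg N hN
  rw [Subsingleton.elim w 0, map_zero]

end Top

section Completion

variable {R S : Type u} [CommRing R] [CommRing S] [Algebra R S] [IsNoetherianRing R]
  [IsNoetherianRing S] [IsLocalRing R] [IsLocalRing S]
  {a p : Ideal R} {d : ℕ}

theorem not_subsingleton_iff [Module.FaithfullyFlat R S]
    [IsPrecomplete (IsLocalRing.maximalIdeal S) S]
    (hm : (IsLocalRing.maximalIdeal R).map (algebraMap R S) = IsLocalRing.maximalIdeal S)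
    (hp : p.IsPrime) (hdim : ringKrullDim (R ⧸ p) ≤ d) :
    ¬ Subsingleton (ExtLC a d (R ⧸ p)) ↔ ∃ q : Ideal S, q.IsPrime ∧ q.comap (algebraMap R S) = p ∧
      ringKrullDim (S ⧸ q) = d ∧ ringKrullDim (S ⧸ (a.map (algebraMap R S) ⊔ q)) = 0 := by
  constructor
  · intro hns
    by_contra! hcon
    refine hns (subsingleton_of_faithfullyFlat (S := S) ?_)
    rw [subsingleton_map_iff (S := S)]
    refine induction_of_le_annihilator (p.map (algebraMap R S))
      (fun N _ _ => Subsingleton (ExtLC (a.map (algebraMap R S)) d N)) ?_ ?_ ?_ ?_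
      (S ⊗[R] (R ⧸ p)) inferInstance ?_
    · intro N _ _ _
      refine subsingleton_of_forall_eq 0 fun z => ?_
      rw [← one_smul S z, ← map_lsmul_apply, Subsingleton.elim (LinearMap.lsmul S N 1) 0,
        map_zero_apply]
    · intro N N' _ _ _ _ e h
      exact (subsingleton_congr e).mpr h
    · intro q hq hpq
      have hpq' : p ≤ q.comap (algebraMap R S) := Ideal.map_le_iff_le_comap.mp hpq
      have hle : ringKrullDim (S ⧸ q) ≤ ringKrullDim (R ⧸ q.comap (algebraMap R S)) :=
        ringKrullDim_quotient_le_quotient_comap _ hm q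
      have hqd : ringKrullDim (S ⧸ q) ≤ d :=
        hle.trans ((ringKrullDim_quotient_le_of_le hpq').trans hdim)
      rcases hqd.lt_or_eq with hlt | heq
      · exact subsingleton_of_ringKrullDim_lt _ d q
          (fun q' _ hq' => (ringKrullDim_quotient_le_of_le hq').trans_lt hlt) _ inferInstance
          Ideal.annihilator_quotient.symm.le
      · have hcomap : q.comap (algebraMap R S) = p := by
          by_contra hne
          have hlt : p < q.comap (algebraMap R S) := lt_of_le_of_ne hpq' (Ne.symm hne)
          have := WithBot.lt_of_add_one_le_of_lt_succ (ringKrullDim_quotient_add_one_le hlt)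
            (WithBot.lt_natCast_succ_iff.mpr hdim)
          exact (hle.trans_lt this).ne heq
        have hne := hcon q hq hcomap heq
        by_cases htop : a.map (algebraMap R S) ⊔ q = ⊤
        · have hatop : a.map (algebraMap R S) = ⊤ := by
            by_contra hne'
            exact Ideal.IsPrime.ne_top' (I := IsLocalRing.maximalIdeal S) (top_unique (htop.ge.trans
              (sup_le (IsLocalRing.le_maximalIdeal hne') (IsLocalRing.le_maximalIdeal hq.ne_top))))
          rw [hatop]
          exact subsingleton_of_eq_top rfl _ _
        · obtain ⟨P, hP, hPm, hleP⟩ : ∃ P : Ideal S, P.IsPrime ∧ P ≠ IsLocalRing.maximalIdeal S ∧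
              a.map (algebraMap R S) ⊔ q ≤ P := by
            by_contra! hmax
            refine hne ?_
            have : Nontrivial (S ⧸ a.map (algebraMap R S) ⊔ q) :=
              Ideal.Quotient.nontrivial_iff.mpr htop
            rw [← ringKrullDimZero_iff_ringKrullDim_eq_zero]
            refine Ring.KrullDimLE.mk₀ fun J hJ => ?_
            have hJmax : J.comap (Ideal.Quotient.mk _) = IsLocalRing.maximalIdeal S := by
              by_contra hJne
              exact hmax _ (Ideal.comap_isPrime _ _) hJne (Ideal.mk_ker.ge.trans (Ideal.comap_mono bot_le))
            rw [← Ideal.map_comap_of_surjective _ Ideal.Quotient.mk_surjective J, hJmax]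
            refine (Ideal.map_eq_top_or_isMaximal_of_surjective _ Ideal.Quotient.mk_surjective
              (IsLocalRing.maximalIdeal.isMaximal S)).resolve_left fun hJtop => hJ.ne_top ?_
            rw [← Ideal.map_comap_of_surjective _ Ideal.Quotient.mk_surjective J, hJmax, hJtop]
          exact subsingleton_of_le_ne_maximalIdeal hPm (le_sup_left.trans hleP) d q hq
            (le_sup_right.trans hleP) hqd
    · intro N₁ N₂ N₃ _ _ _ _ _ _ f g hf hg hfg h₁ h₃
      exact subsingleton_mid hf hg hfg h₁ h₃
    · rw [Ideal.map_le_iff_le_comap]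
      intro r hr
      refine Module.mem_annihilator.mpr fun x => ?_
      rw [algebraMap_smul]
      induction x with
      | zero => rw [smul_zero]
      | add x y hx hy => rw [smul_add, hx, hy, add_zero]
      | tmul s y =>
        rw [← TensorProduct.tmul_smul,
          Module.mem_annihilator.mp (Ideal.annihilator_quotient.symm.le hr) y,
          TensorProduct.tmul_zero]
  · rintro ⟨q, hq, rfl, hqd, hq0⟩ hsub
    have htop : a.map (algebraMap R S) ⊔ q ≠ ⊤ := by
      intro h
      have := Ideal.Quotient.subsingleton_iff.mpr h
      rw [ringKrullDim_eq_bot_of_subsingleton] at hq0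
      exact absurd hq0 (by simp)
    refine not_subsingleton_of_ringKrullDim_eq (a := a.map (algebraMap R S))
      (le_sup_left.trans (IsLocalRing.le_maximalIdeal htop)) d q hq hqd (fun q' hq' h₁ h₂ => ?_) ?_
    · refine eq_maximalIdeal_of_ringKrullDim_quotient_le_zero ?_
      exact (ringKrullDim_quotient_le_of_le (sup_le h₂ h₁)).trans hq0.le
    · rw [← subsingleton_map_iff (A := R)]
      refine subsingleton_of_le_annihilator hdim hsub (S ⧸ q) fun r hr => ?_
      have hr' : algebraMap R S r ∈ Module.annihilator S (S ⧸ q) :=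
        Ideal.annihilator_quotient.symm.le hr
      refine Module.mem_annihilator.mpr fun x => ?_
      rw [← algebraMap_smul S]
      exact Module.mem_annihilator.mp hr' x

end Completion

end ExtLC

lemma sSup_eq_natCast_iff {s : Set ℕ} {d : ℕ} (h : ∀ i ∈ s, i ≤ d) :
    sSup {n : WithBot ℕ∞ | ∃ i : ℕ, n = (i : ℕ) ∧ i ∈ s} = (d : WithBot ℕ∞) ↔ d ∈ s := by
  constructor
  · intro hs
    by_contra hd
    have hlt : ∀ i ∈ s, i < d := fun i hi => lt_of_le_of_ne (h i hi) fun he => hd (he ▸ hi)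
    cases d with
    | zero =>
      have : sSup {n : WithBot ℕ∞ | ∃ i : ℕ, n = (i : ℕ) ∧ i ∈ s} ≤ ⊥ :=
        sSup_le fun n ⟨i, _, hi⟩ => absurd (hlt i hi) (Nat.not_lt_zero i)
      rw [hs] at this
      exact absurd this (by simp)
    | succ d =>
      have : sSup {n : WithBot ℕ∞ | ∃ i : ℕ, n = (i : ℕ) ∧ i ∈ s} ≤ (d : WithBot ℕ∞) :=
        sSup_le fun n ⟨i, hn, hi⟩ => hn ▸ by exact_mod_cast Nat.lt_succ_iff.mp (hlt i hi)
      rw [hs] at this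
      exact absurd this (by norm_cast; omega)
  · intro hd
    exact IsGreatest.csSup_eq ⟨⟨d, rfl, hd⟩, fun n ⟨i, hn, hi⟩ => hn ▸ by exact_mod_cast h i hi⟩

lemma cohDim_quotient_eq_iff {R : Type} [CommRing R] [IsNoetherianRing R] {a I : Ideal R} {d : ℕ}
    (hI : ringKrullDim (R ⧸ I) ≤ d) :
    cohDim R a (R ⧸ I) = d ↔ ¬ Subsingleton (ExtLC a d (R ⧸ I)) := by
  have hiff (i : ℕ) : Nontrivial (TopLC R a i (R ⧸ I)) ↔ ¬ Subsingleton (ExtLC a i (R ⧸ I)) := by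
    rw [← not_subsingleton_iff_nontrivial, ← ExtLC.subsingleton_localCohomology_iff]
    rfl
  rw [← hiff]
  refine sSup_eq_natCast_iff (s := {i | Nontrivial (TopLC R a i (R ⧸ I))}) fun i hi => ?_
  by_contra! hlt
  refine (hiff i).mp hi (ExtLC.subsingleton_of_ringKrullDim_lt a i I (fun q _ hq => ?_) _
    inferInstance Ideal.annihilator_quotient.symm.le)
  exact ((ringKrullDim_quotient_le_of_le hq).trans hI).trans_lt (by exact_mod_cast hlt)

/-- Over a Noetherian local ring `(R, m)`, for an ideal `a`, `d : ℕ` and a prime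
`p` with `dim R/p ≤ d`: `cd_R(a, R/p) = d` iff `p` is the contraction of a prime `p*` of the
`m`-adic completion `R̂` with `dim R̂/p* = d` and `dim R̂/(a R̂ + p*) = 0`. -/
theorem stmt_4 (R : Type) [CommRing R] [IsNoetherianRing R] [IsLocalRing R]
    (a : Ideal R) (d : ℕ) (p : Ideal R) (hp : p.IsPrime)
    (hdim : ringKrullDim (R ⧸ p) ≤ (d : WithBot ℕ∞)) :
    cohDim R a (R ⧸ p) = (d : WithBot ℕ∞) ↔
      ∃ q : Ideal (AdicCompletion (IsLocalRing.maximalIdeal R) R), q.IsPrime ∧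
        q.comap (algebraMap R (AdicCompletion (IsLocalRing.maximalIdeal R) R)) = p ∧
        ringKrullDim ((AdicCompletion (IsLocalRing.maximalIdeal R) R) ⧸ q) =
          (d : WithBot ℕ∞) ∧
        ringKrullDim ((AdicCompletion (IsLocalRing.maximalIdeal R) R) ⧸
            (a.map (algebraMap R (AdicCompletion (IsLocalRing.maximalIdeal R) R)) ⊔ q)) =
          (0 : WithBot ℕ∞) := by
  have := AdicCompletion.isNoetherianRing (IsLocalRing.maximalIdeal R)
  have : Module.FaithfullyFlat R (AdicCompletion (IsLocalRing.maximalIdeal R) R) :=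
    .of_flat_of_isLocalHom
  rw [cohDim_quotient_eq_iff hdim]
  exact ExtLC.not_subsingleton_iff AdicCompletion.maximalIdeal_eq_map.symm hp hdim
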